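/- arXiv:2507.07200 — 2 statements merged into one kernel-verified Lean document; each statement's English description precedes it below -/
import Mathlib

section
/- Let X, Y be Polish spaces, p ≥ 1, let E be a stable cone of functions on Y, let μ ∈ P(X), ν ∈ P_p(Y), and let C : X × P_p(Y) → [0,∞] be lower semicontinuous and convex in its second argument. If C is decreasing in the E-order in its second argument (ρ₁ ≼_E ρ₂ implies C(x,ρ₁) ≥ C(x,ρ₂)), then inf_{π ∈ Π(μ,ν)} ∫_X C(x,π_x) dμ(x) = sup { ∫_X ψ^C dμ − ∫_Y ψ dν : ψ ∈ E, ψ bounded from below }. Conversely, if this identity holds for all μ ∈ P(X) and ν ∈ P_p(Y), then C is ≼_E-decreasing in its second argument. -/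
open MeasureTheory Set Filter Topology
open scoped ENNReal

noncomputable section

/-- A Borel measure on a metric space has finite `p`-th moment. -/
def HasMomentPY (p : ℝ) {Y : Type*} [MetricSpace Y] [MeasurableSpace Y]
    (ρ : Measure Y) : Prop :=
  ∀ y₀ : Y, ∫⁻ y, ENNReal.ofReal (dist y y₀ ^ p) ∂ρ ≠ ⊤

/-- `P_p(Y)`: Borel probability measures on `Y` with finite `p`-th moment. -/
abbrev PpY (p : ℝ) (Y : Type*) [MetricSpace Y] [MeasurableSpace Y] : Type _ :=
  {ρ : Measure Y // IsProbabilityMeasure ρ ∧ HasMomentPY p ρ}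

/-- Continuous test functions of growth of order at most `p`. -/
def GrowthPY (p : ℝ) {Y : Type*} [MetricSpace Y] (f : Y → ℝ) : Prop :=
  Continuous f ∧ ∃ K : ℝ, ∃ y₀ : Y, ∀ y, |f y| ≤ K * (1 + dist y y₀ ^ p)

/-- The `p`-weak topology on `P_p(Y)`. -/
instance PpYTopology (p : ℝ) (Y : Type*) [MetricSpace Y] [MeasurableSpace Y] :
    TopologicalSpace (PpY p Y) :=
  ⨅ f : {f : Y → ℝ // GrowthPY p f},
    TopologicalSpace.induced (fun ρ : PpY p Y => ∫ y, f.1 y ∂ρ.1) inferInstance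

/-- `C_{b,p}(Y)`: continuous functions bounded from below by a constant and bounded above
by `K (1 + d_Y(·,y₀)^p)` for some `K > 0`, `y₀ ∈ Y`. -/
def CbpY (p : ℝ) {Y : Type*} [MetricSpace Y] (ψ : Y → ℝ) : Prop :=
  Continuous ψ ∧ (∃ c : ℝ, ∀ y, c ≤ ψ y) ∧
    ∃ K : ℝ, 0 < K ∧ ∃ y₀ : Y, ∀ y, ψ y ≤ K * (1 + dist y y₀ ^ p)

/-- `LSC_p(Y)`: lower semicontinuous functions bounded in absolute value by a multiple of
`1 + d_Y(·,y₀)^p` for some `y₀ ∈ Y`. -/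
def LSCp (p : ℝ) {Y : Type*} [MetricSpace Y] (f : Y → ℝ) : Prop :=
  LowerSemicontinuous f ∧ ∃ K : ℝ, ∃ y₀ : Y, ∀ y, |f y| ≤ K * (1 + dist y y₀ ^ p)

/-- The order induced by a set `E` of (integrable) functions:
`ρ₁ ≼_E ρ₂` iff `∫ f dρ₁ ≤ ∫ f dρ₂` for all `f ∈ E`. -/
def EOrder {Y : Type*} [MeasurableSpace Y] (E : Set (Y → ℝ)) (ρ₁ ρ₂ : Measure Y) : Prop :=
  ∀ f ∈ E, ∫ y, f y ∂ρ₁ ≤ ∫ y, f y ∂ρ₂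

/-- A stable cone of functions on a Polish metric space `Y`: a subset of `LSC_p(Y)`
containing the constants, closed under conic combinations and under pointwise suprema
staying in `LSC_p(Y)`, whose members are suprema of continuous members, and satisfying
the dual representation of the `E`-hull of functions in `C_{b,p}(Y)`. -/
structure StableCone (p : ℝ) (Y : Type*) [MetricSpace Y] [MeasurableSpace Y] where
  carrier : Set (Y → ℝ)
  subset_lscp : ∀ f ∈ carrier, LSCp p f
  const_mem : ∀ c : ℝ, (fun _ => c) ∈ carrier
  add_mem : ∀ f ∈ carrier, ∀ g ∈ carrier, (fun y => f y + g y) ∈ carrier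
  smul_mem : ∀ c : ℝ, 0 ≤ c → ∀ f ∈ carrier, (fun y => c * f y) ∈ carrier
  sup_mem : ∀ S : Set (Y → ℝ), S ⊆ carrier → S.Nonempty →
    (∀ y, BddAbove ((fun f : Y → ℝ => f y) '' S)) →
    LSCp p (fun y => ⨆ f : S, f.1 y) → (fun y => ⨆ f : S, f.1 y) ∈ carrier
  sup_continuous : ∀ f ∈ carrier, ∃ S : Set (Y → ℝ), S ⊆ carrier ∧ S.Nonempty ∧
    (∀ g ∈ S, Continuous g) ∧ (∀ y, BddAbove ((fun g : Y → ℝ => g y) '' S)) ∧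
    ∀ y, f y = ⨆ g : S, g.1 y
  hull_repr : ∀ f : Y → ℝ, CbpY p f → ∀ y : Y,
    (⨆ φ : {φ : Y → ℝ // φ ∈ carrier ∧ ∀ z, φ z ≤ f z}, (φ.1 y : EReal))
      = ⨅ ρ : {ρ : PpY p Y // EOrder carrier (Measure.dirac y) ρ.1},
          ((∫ z, f z ∂ρ.1.1 : ℝ) : EReal)

open scoped Classical in
/-- The nonnegative part of an extended real, as an extended nonnegative real. -/
def erealToENN (x : EReal) : ℝ≥0∞ := if x = ⊤ then ⊤ else ENNReal.ofReal x.toReal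

/-- Canonical extended integral of an `EReal`-valued function. -/
def eInt {α : Type*} [MeasurableSpace α] (μ : Measure α) (f : α → EReal) : EReal :=
  ((∫⁻ x, erealToENN (f x) ∂μ : ℝ≥0∞) : EReal) -
    ((∫⁻ x, erealToENN (-(f x)) ∂μ : ℝ≥0∞) : EReal)

/-- `π` is a coupling of `μ` and `ν`. -/
def IsCoupling {X Y : Type*} [MeasurableSpace X] [MeasurableSpace Y]
    (π : Measure (X × Y)) (μ : Measure X) (ν : Measure Y) : Prop :=
  IsProbabilityMeasure π ∧ π.map Prod.fst = μ ∧ π.map Prod.snd = ν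

open scoped Classical in
/-- Disintegration of a measure on a product space with respect to its first marginal. -/
def disint {X : Type*} [MeasurableSpace X] {Y : Type*} [MeasurableSpace Y]
    [StandardBorelSpace Y] [Nonempty Y] (π : Measure (X × Y)) :
    ProbabilityTheory.Kernel X Y :=
  if h : IsFiniteMeasure π then (haveI := h; π.condKernel) else 0

/-- The primal weak optimal transport value. -/
def primalY {X : Type*} [MeasurableSpace X] {Y : Type*} [MeasurableSpace Y]
    [StandardBorelSpace Y] [Nonempty Y]
    (μ : Measure X) (ν : Measure Y) (C : X → Measure Y → ℝ≥0∞) : ℝ≥0∞ :=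
  ⨅ π : {π : Measure (X × Y) // IsCoupling π μ ν}, ∫⁻ x, C x (disint π.1 x) ∂μ

/-- The `C`-conjugate `ψ^C (x) = inf_{ρ ∈ P_p(Y)} ρ(ψ) + C(x, ρ)`. -/
def conjY (p : ℝ) {X : Type*} [MeasurableSpace X] {Y : Type*} [MetricSpace Y]
    [MeasurableSpace Y] (C : X → Measure Y → ℝ≥0∞) (ψ : Y → ℝ) (x : X) : EReal :=
  ⨅ ρ : PpY p Y, ((∫ y, ψ y ∂ρ.1 : ℝ) : EReal) + ((C x ρ.1 : ℝ≥0∞) : EReal)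

end

lemma isCompact_setOf_forall_le (n : ℕ → ℕ) : IsCompact {x : ℕ → ℕ | ∀ i, x i ≤ n i} := by
  convert isCompact_univ_pi (fun i => (finite_Iic (n i)).isCompact) using 1
  ext x
  simp [Pi.le_def]

/-- Every open set containing the compact box `{x | ∀ i, x i ≤ n i}` contains a box constraining
only finitely many coordinates. -/
lemma exists_finite_box_subset_of_isOpen (n : ℕ → ℕ) {U : Set (ℕ → ℕ)} (hU : IsOpen U)
    (h : {x | ∀ i, x i ≤ n i} ⊆ U) : ∃ k, {x : ℕ → ℕ | ∀ i < k, x i ≤ n i} ⊆ U := by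
  by_contra! hcon
  simp only [not_subset] at hcon
  choose x hx hxU using hcon
  have hcpt := isCompact_setOf_forall_le n
  obtain ⟨y, hy, φ, hφ, hlim⟩ := hcpt.tendsto_subseq (x := fun k i => min (x k i) (n i))
    (fun k i => min_le_right _ _)
  have hxlim : Tendsto (x ∘ φ) atTop (𝓝 y) := by
    rw [tendsto_pi_nhds] at hlim ⊢
    intro i
    refine (hlim i).congr' ?_
    filter_upwards [hφ.tendsto_atTop.eventually_gt_atTop i] with k hk
    simpa using hx (φ k) i hk
  obtain ⟨k, hk⟩ := (hxlim.eventually (hU.mem_nhds (h hy))).exists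
  exact hxU _ hk

lemma exists_box_lt_measure_image {X : Type*} [MeasurableSpace X] (μ : Measure X)
    (f : (ℕ → ℕ) → X) {a : ℝ≥0∞} (ha : a < μ (range f)) :
    ∃ n : ℕ → ℕ, ∀ k, a < μ (f '' {x | ∀ i < k, x i ≤ n i}) := by
  have step : ∀ (k : ℕ) (n : ℕ → ℕ), a < μ (f '' {x | ∀ i < k, x i ≤ n i}) →
      ∃ j, a < μ (f '' {x | ∀ i < k + 1, x i ≤ Function.update n k j i}) := by
    intro k n h
    have hmono : Monotone fun j => f '' {x | (∀ i < k, x i ≤ n i) ∧ x k ≤ j} := by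
      intro j j' hj
      exact image_mono fun x hx => ⟨hx.1, hx.2.trans hj⟩
    have hun : f '' {x | ∀ i < k, x i ≤ n i} =
        ⋃ j, f '' {x | (∀ i < k, x i ≤ n i) ∧ x k ≤ j} := by
      rw [← image_iUnion]
      congr 1
      ext x
      simp only [mem_ofPred_eq, mem_iUnion]
      exact ⟨fun hx => ⟨x k, hx, le_rfl⟩, fun ⟨j, hx, _⟩ => hx⟩
    rw [hun, hmono.measure_iUnion, lt_iSup_iff] at h
    obtain ⟨j, hj⟩ := h
    refine ⟨j, hj.trans_le (measure_mono (image_mono ?_))⟩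
    rintro x ⟨hx, hxj⟩ i hi
    rcases Nat.lt_succ_iff_lt_or_eq.1 hi with hi | rfl
    · rw [Function.update_of_ne hi.ne]; exact hx i hi
    · simpa using hxj
  choose! J hJ using step
  let N : ℕ → ℕ → ℕ := fun k => Nat.rec (fun _ => 0) (fun k n => Function.update n k (J k n)) k
  have hN : ∀ k, N (k + 1) = Function.update (N k) k (J k (N k)) := fun k => rfl
  have hlt : ∀ k, a < μ (f '' {x | ∀ i < k, x i ≤ N k i}) := by
    intro k
    induction k with
    | zero => simpa [image_univ] using ha
    | succ k ih => rw [hN]; exact hJ k _ ih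
  have hstab : ∀ i k, i < k → N k i = N (i + 1) i := by
    intro i k hik
    induction k with
    | zero => omega
    | succ k ih =>
      rcases Nat.lt_succ_iff_lt_or_eq.1 hik with h | rfl
      · rw [hN, Function.update_of_ne h.ne, ih h]
      · rfl
  refine ⟨fun i => N (i + 1) i, fun k => ?_⟩
  convert hlt k using 5 with x
  exact forall₂_congr fun i hi => by rw [hstab i k hi]

/-- Continuous images of the Baire space are universally measurable. -/
lemma nullMeasurableSet_range_of_continuous {X : Type*} [TopologicalSpace X] [PolishSpace X]
    [MeasurableSpace X] [BorelSpace X] (μ : Measure X) [IsFiniteMeasure μ]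
    {f : (ℕ → ℕ) → X} (hf : Continuous f) : NullMeasurableSet (range f) μ := by
  let := TopologicalSpace.upgradeIsCompletelyMetrizable X
  have key : ∀ a < μ (range f), ∃ K ⊆ range f, IsClosed K ∧ a ≤ μ K := by
    intro a ha
    obtain ⟨n, hn⟩ := exists_box_lt_measure_image μ f ha
    have hcpt := isCompact_setOf_forall_le n
    refine ⟨_, image_subset_range _ _, (hcpt.image hf).isClosed, ?_⟩
    by_contra! hlt
    obtain ⟨U, hU, hUo, hUlt⟩ := Set.exists_isOpen_lt_of_lt _ _ hlt
    obtain ⟨k, hk⟩ := exists_finite_box_subset_of_isOpen n (hUo.preimage hf) (image_subset_iff.1 hU)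
    exact absurd ((hn k).trans_le (measure_mono (image_subset_iff.2 hk))) hUlt.not_gt
  rcases eq_or_ne (μ (range f)) 0 with h0 | h0
  · exact NullMeasurableSet.of_null h0
  obtain ⟨a, -, ha, hlim⟩ := exists_seq_strictMono_tendsto' (pos_iff_ne_zero.2 h0)
  choose K hKs hKc hKa using fun k => key (a k) (ha k).2
  have hsub : (⋃ k, K k) ⊆ range f := iUnion_subset hKs
  have hmeas : MeasurableSet (⋃ k, K k) := .iUnion fun k => (hKc k).measurableSet
  have hle : μ (range f) ≤ μ (⋃ k, K k) :=
    le_of_tendsto' hlim fun k => (hKa k).trans (measure_mono (subset_iUnion K k))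
  exact hmeas.nullMeasurableSet.congr
    (ae_eq_of_subset_of_measure_ge hsub hle hmeas.nullMeasurableSet (measure_ne_top _ _))

lemma MeasureTheory.AnalyticSet.nullMeasurableSet {X : Type*} [TopologicalSpace X] [PolishSpace X]
    [MeasurableSpace X] [BorelSpace X] (μ : Measure X) [IsFiniteMeasure μ]
    {s : Set X} (hs : AnalyticSet s) : NullMeasurableSet s μ := by
  rw [AnalyticSet] at hs
  rcases hs with rfl | ⟨f, hf, rfl⟩
  · exact .empty
  · exact nullMeasurableSet_range_of_continuous μ hf

/-- The first `k` terms (in reverse order) of the lexicographically least point of the fibre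
of `f` over `x`. -/
noncomputable def lexMinInit {X : Type*} (f : (ℕ → ℕ) → X) (x : X) : ℕ → List ℕ
  | 0 => []
  | k + 1 => sInf {j | x ∈ f '' {b | PiNat.res b (k + 1) = j :: lexMinInit f x k}} ::
      lexMinInit f x k

/-- The lexicographically least point of the fibre of `f` over `x`. -/
noncomputable def lexMin {X : Type*} (f : (ℕ → ℕ) → X) (x : X) (k : ℕ) : ℕ :=
  sInf {j | x ∈ f '' {b | PiNat.res b (k + 1) = j :: lexMinInit f x k}}

lemma lexMinInit_succ {X : Type*} (f : (ℕ → ℕ) → X) (x : X) (k : ℕ) :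
    lexMinInit f x (k + 1) = lexMin f x k :: lexMinInit f x k := rfl

lemma res_lexMin {X : Type*} (f : (ℕ → ℕ) → X) (x : X) (k : ℕ) :
    PiNat.res (lexMin f x) k = lexMinInit f x k := by
  induction k with
  | zero => rfl
  | succ k ih => rw [PiNat.res_succ, ih, lexMinInit_succ]

lemma apply_lexMin {X : Type*} [TopologicalSpace X] [T2Space X] {f : (ℕ → ℕ) → X}
    (hf : Continuous f) {x : X} (hx : x ∈ range f) : f (lexMin f x) = x := by
  have key : ∀ k, x ∈ f '' {b | PiNat.res b k = lexMinInit f x k} := by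
    intro k
    induction k with
    | zero => simpa [lexMinInit] using hx
    | succ k ih =>
      obtain ⟨b, hb, hbx⟩ := ih
      have hne : {j | x ∈ f '' {b | PiNat.res b (k + 1) = j :: lexMinInit f x k}}.Nonempty :=
        ⟨b k, b, by simpa using hb, hbx⟩
      exact Nat.sInf_mem hne
  choose b hb hbx using key
  have hlim : Tendsto b atTop (𝓝 (lexMin f x)) := by
    rw [tendsto_pi_nhds]
    intro i
    refine tendsto_const_nhds.congr' ?_
    filter_upwards [eventually_gt_atTop i] with k hk
    have := hb k
    rw [mem_ofPred_eq, ← res_lexMin] at this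
    exact (PiNat.res_eq_res.1 this hk).symm
  have h2 := (hf.tendsto _).comp hlim
  simp only [Function.comp_def, hbx] at h2
  exact tendsto_nhds_unique h2 tendsto_const_nhds |>.symm ▸ rfl

lemma isClosed_setOf_res_eq (k : ℕ) (l : List ℕ) : IsClosed {b : ℕ → ℕ | PiNat.res b k = l} := by
  have : Continuous fun b : ℕ → ℕ => (fun i : Fin k => b i) := by fun_prop
  by_cases h : ∃ a : ℕ → ℕ, PiNat.res a k = l
  · obtain ⟨a, rfl⟩ := h
    simp only [PiNat.res_eq_res, ofPred_forall]
    exact isClosed_iInter fun i => isClosed_iInter fun _ =>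
      isClosed_eq (continuous_apply i) continuous_const
  · convert isClosed_empty
    exact eq_empty_of_forall_notMem fun b hb => h ⟨b, hb⟩

lemma nullMeasurable_lexMin {X : Type*} [TopologicalSpace X] [PolishSpace X]
    [MeasurableSpace X] [BorelSpace X] (μ : Measure X) [IsFiniteMeasure μ]
    {f : (ℕ → ℕ) → X} (hf : Continuous f) : NullMeasurable (lexMin f) μ := by
  have hcyl : ∀ k l, NullMeasurableSet (f '' {b | PiNat.res b k = l}) μ := fun k l =>
    ((isClosed_setOf_res_eq k l).analyticSet.image_of_continuous hf).nullMeasurableSet μ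
  have hnext : ∀ k l j, NullMeasurableSet
      {x | sInf {j | x ∈ f '' {b | PiNat.res b (k + 1) = j :: l}} = j} μ := by
    intro k l j
    have hset : {x | sInf {j | x ∈ f '' {b | PiNat.res b (k + 1) = j :: l}} = j} =
        (f '' {b | PiNat.res b (k + 1) = j :: l} \
            ⋃ i < j, f '' {b | PiNat.res b (k + 1) = i :: l}) ∪
          (if j = 0 then (⋃ i, f '' {b | PiNat.res b (k + 1) = i :: l})ᶜ else ∅) := by
      ext x
      set S := {j | x ∈ f '' {b | PiNat.res b (k + 1) = j :: l}} with hS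
      have hmem : ∀ i, x ∈ f '' {b | PiNat.res b (k + 1) = i :: l} ↔ i ∈ S := fun i => Iff.rfl
      have hx : x ∈ {x | sInf {j | x ∈ f '' {b | PiNat.res b (k + 1) = j :: l}} = j} ↔
        sInf S = j := Iff.rfl
      have hif : x ∈ (if j = 0 then (⋃ i, f '' {b | PiNat.res b (k + 1) = i :: l})ᶜ else ∅) ↔
          j = 0 ∧ S = ∅ := by
        split_ifs with h0
        · simp only [h0, mem_compl_iff, mem_iUnion, hmem, not_exists, true_and,
            eq_empty_iff_forall_notMem]
        · simp [h0]
      simp only [hx, mem_union, hif, Set.mem_sdiff, mem_iUnion, hmem, not_exists]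
      constructor
      · rintro rfl
        rcases S.eq_empty_or_nonempty with h | h
        · exact Or.inr ⟨by simp [h], h⟩
        · exact Or.inl ⟨Nat.sInf_mem h, fun i hi => Nat.notMem_of_lt_sInf hi⟩
      · rintro (⟨h1, h2⟩ | ⟨rfl, h⟩)
        · exact le_antisymm (Nat.sInf_le h1) (not_lt.1 fun h => h2 _ h (Nat.sInf_mem ⟨j, h1⟩))
        · simp [h]
    rw [hset]
    refine ((hcyl _ _).diff (.iUnion fun i => .iUnion fun _ => hcyl _ _)).union ?_
    split_ifs
    · exact (NullMeasurableSet.iUnion fun i => hcyl _ _).compl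
    · exact .empty
  have hpre : ∀ k l, NullMeasurableSet {x | lexMinInit f x k = l} μ := by
    intro k
    induction k with
    | zero => intro l; by_cases h : ([] : List ℕ) = l <;> simp [lexMinInit, h]
    | succ k ih =>
      intro l
      cases l with
      | nil => simp [lexMinInit]
      | cons j l =>
        convert (hnext k l j).inter (ih l) using 1
        ext x
        simp only [lexMinInit, List.cons.injEq, mem_ofPred_eq, mem_inter_iff]
        refine and_congr_left fun h => ?_
        rw [h]
  have hcoord : ∀ k, NullMeasurable (fun x => lexMin f x k) μ := by
    intro k
    have hfib : ∀ j, NullMeasurableSet ((fun x => lexMin f x k) ⁻¹' {j}) μ := by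
      intro j
      have : (fun x => lexMin f x k) ⁻¹' {j} =
          ⋃ l : List ℕ, {x | lexMinInit f x (k + 1) = j :: l} := by
        ext x
        simp [lexMinInit_succ]
      rw [this]
      exact .iUnion fun l => hpre _ _
    exact measurable_to_countable' (β := NullMeasurableSpace X μ) hfib
  exact measurable_pi_iff.2 hcoord

/-- **Jankov–von Neumann selection**, almost-everywhere version. -/
lemma exists_measurable_selection {X Z : Type*} [TopologicalSpace X] [PolishSpace X]
    [MeasurableSpace X] [BorelSpace X] (μ : Measure X) [IsFiniteMeasure μ]
    [TopologicalSpace Z] [PolishSpace Z] [MeasurableSpace Z] [BorelSpace Z] [Nonempty Z]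
    {B : Set (X × Z)} (hB : MeasurableSet B) :
    ∃ s : X → Z, Measurable s ∧ ∀ᵐ x ∂μ, (∃ z, (x, z) ∈ B) → (x, s x) ∈ B := by
  have hA := hB.analyticSet
  rw [AnalyticSet] at hA
  rcases hA with rfl | ⟨F, hF, rfl⟩
  · exact ⟨fun _ => Classical.arbitrary Z, measurable_const, by simp⟩
  have hf : Continuous (fun b => (F b).1) := by fun_prop
  have hae := (nullMeasurable_lexMin μ hf).aemeasurable
  refine ⟨fun x => (F (hae.mk _ x)).2, (hF.snd.measurable).comp hae.measurable_mk, ?_⟩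
  filter_upwards [hae.ae_eq_mk] with x hx
  rintro ⟨z, b, hb⟩
  refine ⟨hae.mk _ x, ?_⟩
  have : (F (lexMin (fun b => (F b).1) x)).1 = x :=
    apply_lexMin hf ⟨b, by simp [hb]⟩
  rw [← hx]
  exact Prod.ext this rfl

lemma integral_abs_sub_le_norm {K : Type*} [TopologicalSpace K] [CompactSpace K]
    [MeasurableSpace K] [OpensMeasurableSpace K]
    (m : Measure K) [IsProbabilityMeasure m] (f g : C(K, ℝ)) :
    dist (∫ x, f x ∂m) (∫ x, g x ∂m) ≤ dist f g := by
  have hi (f : C(K, ℝ)) : Integrable (fun x => f x) m :=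
    Integrable.of_bound f.continuous.measurable.aestronglyMeasurable ‖f‖
      (.of_forall fun x => f.norm_coe_le_norm x)
  rw [dist_eq_norm, ← integral_sub (hi f) (hi g)]
  refine (norm_integral_le_of_norm_le_const (C := dist f g) (.of_forall fun x => ?_)).trans ?_
  · exact (dist_eq_norm (f x) (g x)).symm.trans_le (ContinuousMap.dist_apply_le_dist x)
  · simp

/-- Countably many continuous functions bounded by one separate the probability measures of a
compact metrizable space. -/
lemma exists_seq_continuousMap_separating (K : Type*) [TopologicalSpace K] [CompactSpace K]
    [TopologicalSpace.MetrizableSpace K] [MeasurableSpace K] [BorelSpace K] :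
    ∃ g : ℕ → C(K, ℝ), (∀ i x, |g i x| ≤ 1) ∧
      Function.Injective fun (m : ProbabilityMeasure K) i => ∫ x, g i x ∂(m : Measure K) := by
  let := TopologicalSpace.metrizableSpaceMetric K
  set d := TopologicalSpace.denseSeq C(K, ℝ)
  refine ⟨fun i => (1 + ‖d i‖)⁻¹ • d i, fun i x => ?_, fun m m' h => ?_⟩
  · have h1 : |d i x| ≤ ‖d i‖ := (d i).norm_coe_le_norm x
    have h2 := norm_nonneg (d i)
    simp only [ContinuousMap.coe_smul, Pi.smul_apply, smul_eq_mul, abs_mul, abs_inv,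
      abs_of_pos (by linarith : 0 < 1 + ‖d i‖)]
    rw [inv_mul_le_iff₀ (by linarith)]
    linarith
  · have hc (m : ProbabilityMeasure K) :
        Continuous fun f : C(K, ℝ) => ∫ x, f x ∂(m : Measure K) :=
      LipschitzWith.continuous (K := 1) (LipschitzWith.of_dist_le_mul fun f g => by
        simpa using integral_abs_sub_le_norm (m : Measure K) f g)
    have hd : (fun f : C(K, ℝ) => ∫ x, f x ∂(m : Measure K)) =
        fun f => ∫ x, f x ∂(m' : Measure K) := by
      refine (TopologicalSpace.denseRange_denseSeq C(K, ℝ)).equalizer (hc m) (hc m') ?_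
      ext i
      have := congrFun h i
      simp only [ContinuousMap.coe_smul, Pi.smul_apply, smul_eq_mul, integral_const_mul] at this
      exact mul_left_cancel₀ (inv_ne_zero (by positivity)) this
    refine Subtype.ext (ext_of_forall_integral_eq_of_IsFiniteMeasure (μ := (m : Measure K))
      (ν := (m' : Measure K)) fun f => ?_)
    exact congrFun hd f.toContinuousMap

lemma isClosedEmbedding_integral {K : Type*} [TopologicalSpace K] [CompactSpace K]
    [TopologicalSpace.MetrizableSpace K] [MeasurableSpace K] [BorelSpace K] {g : ℕ → C(K, ℝ)}
    (hg : Function.Injective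
      fun (m : ProbabilityMeasure K) i => ∫ x, g i x ∂(m : Measure K)) :
    IsClosedEmbedding fun (m : ProbabilityMeasure K) i => ∫ x, g i x ∂(m : Measure K) := by
  let := TopologicalSpace.metrizableSpaceMetric K
  refine Continuous.isClosedEmbedding ?_ hg
  exact continuous_pi fun i => ProbabilityMeasure.continuous_integral_continuousMap (g i)

/-- A Giry-measurable left inverse of the integration map. -/
lemma exists_measurable_leftInverse_integral {K : Type*} [TopologicalSpace K] [CompactSpace K]
    [TopologicalSpace.MetrizableSpace K] [MeasurableSpace K] [BorelSpace K] [Nonempty K]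
    {g : ℕ → C(K, ℝ)}
    (hg : Function.Injective
      fun (m : ProbabilityMeasure K) i => ∫ x, g i x ∂(m : Measure K)) :
    ∃ R : (ℕ → ℝ) → ProbabilityMeasure K, Measurable R ∧
      ∀ m : ProbabilityMeasure K, R (fun i => ∫ x, g i x ∂(m : Measure K)) = m := by
  let := TopologicalSpace.metrizableSpaceMetric K
  have hid : @Measurable _ _ (borel (ProbabilityMeasure K)) inferInstance
      (id : ProbabilityMeasure K → ProbabilityMeasure K) := by
    let : MeasurableSpace (ProbabilityMeasure K) := borel _
    have : BorelSpace (ProbabilityMeasure K) := ⟨rfl⟩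
    have : Measurable fun m : ProbabilityMeasure K => (m : Measure K) := by
      refine Measurable.measure_of_isPiSystem_of_isProbabilityMeasure
        (S := {s | IsOpen s}) (BorelSpace.measurable_eq (α := K)) isPiSystem_isOpen fun s hs => ?_
      refine LowerSemicontinuous.measurable (lowerSemicontinuous_iff_le_liminf.2 fun m => ?_)
      exact ProbabilityMeasure.le_liminf_measure_open_of_tendsto tendsto_id hs
    exact this.subtype_mk
  have key : ∃ R : (ℕ → ℝ) → ProbabilityMeasure K,
      @Measurable _ _ _ (borel (ProbabilityMeasure K)) R ∧
      ∀ m : ProbabilityMeasure K, R (fun i => ∫ x, g i x ∂(m : Measure K)) = m := by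
    let : MeasurableSpace (ProbabilityMeasure K) := borel _
    have : BorelSpace (ProbabilityMeasure K) := ⟨rfl⟩
    obtain ⟨R, hR, h⟩ :=
      (isClosedEmbedding_integral hg).measurableEmbedding.exists_measurable_extend
      measurable_id fun _ => ⟨⟨Measure.dirac (Classical.arbitrary K), inferInstance⟩⟩
    exact ⟨R, hR, fun m => congrFun h m⟩
  obtain ⟨R, hR, h⟩ := key
  exact ⟨R, hid.comp hR, h⟩

section MeasureBind

variable {X Y : Type*} [MeasurableSpace X] [MeasurableSpace Y]

lemma measurable_integral_measure {f : Y → ℝ} (hf : Measurable f) :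
    Measurable fun ρ : Measure Y => ∫ y, f y ∂ρ :=
  (StronglyMeasurable.integral_kernel (κ := ⟨id, measurable_id⟩) hf.stronglyMeasurable).measurable

lemma integral_bind_of_integrable {μ : Measure X} {κ : X → Measure Y} (hκ : Measurable κ)
    {f : Y → ℝ} (hf : Integrable f (μ.bind κ)) :
    ∫ y, f y ∂(μ.bind κ) = ∫ x, ∫ y, f y ∂(κ x) ∂μ := by
  have h := Measure.comp_eq_comp_const_apply (μ := μ) (κ := ⟨κ, hκ⟩)
  change μ.bind κ = _ at h
  rw [h] at hf ⊢
  exact ProbabilityTheory.Kernel.integral_comp hf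

lemma integrable_of_abs_le_one {m : Measure Y} [IsFiniteMeasure m] {f : Y → ℝ}
    (hf : Measurable f) (h : ∀ y, |f y| ≤ 1) : Integrable f m :=
  Integrable.of_bound hf.aestronglyMeasurable 1 (.of_forall h)

lemma abs_integral_le_one {m : Measure Y} [IsProbabilityMeasure m] {f : Y → ℝ}
    (h : ∀ y, |f y| ≤ 1) : |∫ y, f y ∂m| ≤ 1 := by
  simpa using norm_integral_le_of_norm_le_const (μ := m) (f := f) (C := 1) (.of_forall h)

lemma isProbabilityMeasure_bind_of_measurable {μ : Measure X} [IsProbabilityMeasure μ]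
    {κ : X → Measure Y}
    (hκ : Measurable κ) (h : ∀ x, IsProbabilityMeasure (κ x)) :
    IsProbabilityMeasure (μ.bind κ) :=
  ⟨by simp [Measure.bind_apply .univ hκ.aemeasurable]⟩

end MeasureBind

instance {p : ℝ} {Y : Type*} [MetricSpace Y] [MeasurableSpace Y] (ρ : PpY p Y) :
    IsProbabilityMeasure ρ.1 := ρ.2.1

lemma dist_rpow_le {p : ℝ} {Y : Type*} [MetricSpace Y] (hp : 0 ≤ p) (y y₀ y₁ : Y) :
    dist y y₁ ^ p ≤ 2 ^ p * (dist y y₀ ^ p + dist y₀ y₁ ^ p) := by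
  have h0 : (0 : ℝ) ≤ dist y y₀ := dist_nonneg
  have h1 : (0 : ℝ) ≤ dist y₀ y₁ := dist_nonneg
  have h2 : dist y y₁ ≤ 2 * max (dist y y₀) (dist y₀ y₁) := by
    have := dist_triangle y y₀ y₁
    have := le_max_left (dist y y₀) (dist y₀ y₁)
    have := le_max_right (dist y y₀) (dist y₀ y₁)
    linarith
  calc dist y y₁ ^ p ≤ (2 * max (dist y y₀) (dist y₀ y₁)) ^ p :=
        Real.rpow_le_rpow dist_nonneg h2 hp
    _ = 2 ^ p * max (dist y y₀) (dist y₀ y₁) ^ p :=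
        Real.mul_rpow (by norm_num) (h0.trans (le_max_left _ _))
    _ ≤ 2 ^ p * (dist y y₀ ^ p + dist y₀ y₁ ^ p) := by
        gcongr
        rcases max_cases (dist y y₀) (dist y₀ y₁) with ⟨h, -⟩ | ⟨h, -⟩ <;> rw [h]
        · exact le_add_of_nonneg_right (Real.rpow_nonneg h1 _)
        · exact le_add_of_nonneg_left (Real.rpow_nonneg h0 _)

section Decode

variable {p : ℝ} {Y : Type*} [MetricSpace Y] [MeasurableSpace Y]

lemma hasMomentPY_of_lintegral_ne_top (hp : 0 ≤ p) {ρ : Measure Y} [IsFiniteMeasure ρ] {y₀ : Y}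
    (h : ∫⁻ y, ENNReal.ofReal (dist y y₀ ^ p) ∂ρ ≠ ⊤) : HasMomentPY p ρ := by
  intro y₁
  refine ne_top_of_le_ne_top (b := ENNReal.ofReal (2 ^ p) *
    (∫⁻ y, ENNReal.ofReal (dist y y₀ ^ p) ∂ρ + ENNReal.ofReal (dist y₀ y₁ ^ p) * ρ univ)) ?_ ?_
  · exact ENNReal.mul_ne_top ENNReal.ofReal_ne_top (ENNReal.add_ne_top.2 ⟨h,
      ENNReal.mul_ne_top ENNReal.ofReal_ne_top (measure_ne_top _ _)⟩)
  · rw [← lintegral_const, ← lintegral_add_right _ measurable_const,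
      ← lintegral_const_mul' _ _ ENNReal.ofReal_ne_top]
    refine lintegral_mono fun y => ?_
    rw [← ENNReal.ofReal_add (by positivity) (by positivity), ← ENNReal.ofReal_mul (by positivity)]
    exact ENNReal.ofReal_le_ofReal (dist_rpow_le hp y y₀ y₁)

lemma hasMomentPY_dirac [BorelSpace Y] (y : Y) : HasMomentPY p (Measure.dirac y) := by
  intro y₁
  rw [lintegral_dirac]
  exact ENNReal.ofReal_ne_top

/-- The vector of integrals against a sequence of test functions. -/
noncomputable def integralSeq {Y : Type*} [MeasurableSpace Y] (φ : ℕ → Y → ℝ) (ρ : Measure Y) :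
    ℕ → ℝ := fun i => ∫ y, φ i y ∂ρ

/-- A sequence of bounded continuous functions determining weak convergence on `P(Y)`, together
with a measurable way of recovering elements of `P_p(Y)` from their sequence of integrals. -/
structure TestSequence (p : ℝ) (Y : Type*) [MetricSpace Y] [MeasurableSpace Y] where
  φ : ℕ → Y → ℝ
  continuous : ∀ i, Continuous (φ i)
  abs_le_one : ∀ i y, |φ i y| ≤ 1
  tendsto_measure_of_isOpen : ∀ (ρ : Measure Y) (ρs : ℕ → Measure Y), IsProbabilityMeasure ρ →
    (∀ k, IsProbabilityMeasure (ρs k)) →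
    Tendsto (fun k => integralSeq φ (ρs k)) atTop (𝓝 (integralSeq φ ρ)) →
    ∀ U, IsOpen U → ρ U ≤ liminf (fun k => ρs k U) atTop
  decode : (ℕ → ℝ) → PpY p Y
  measurable_decode : Measurable decode
  decode_integralSeq : ∀ ρ : PpY p Y, decode (integralSeq φ ρ.1) = ρ
  integralSeq_decode_ae : ∀ {X : Type*} [MeasurableSpace X] (μ : Measure X),
    IsProbabilityMeasure μ → ∀ (κ : ℕ → X → PpY p Y), (∀ k, Measurable (κ k)) →
    ∀ v : X → ℕ → ℝ, Measurable v →
    (∀ᵐ x ∂μ, Tendsto (fun k => integralSeq φ (κ k x).1) atTop (𝓝 (v x))) →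
    ∀ ν : PpY p Y, (∀ i, Tendsto (fun k => ∫ x, integralSeq φ (κ k x).1 i ∂μ) atTop
      (𝓝 (∫ y, φ i y ∂ν.1))) →
    ∀ᵐ x ∂μ, integralSeq φ (decode (v x)).1 = v x

lemma exists_testSequence [PolishSpace Y] [BorelSpace Y] [Nonempty Y] (hp : 0 ≤ p) :
    Nonempty (TestSequence p Y) := by
  obtain ⟨F, hF⟩ := Metric.PiNatEmbed.exists_embedding_to_hilbert_cube (X := Y)
  obtain ⟨g, hg1, hginj⟩ := exists_seq_continuousMap_separating (ℕ → unitInterval)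
  obtain ⟨R, hR, hRg⟩ := exists_measurable_leftInverse_integral hginj
  have hFm : MeasurableEmbedding F := hF.continuous.measurableEmbedding hF.injective
  have hmapP (ρ : Measure Y) [IsProbabilityMeasure ρ] : IsProbabilityMeasure (ρ.map F) :=
    Measure.isProbabilityMeasure_map hFm.measurable.aemeasurable
  have hmap (ρ : Measure Y) : integralSeq (fun i => g i ∘ F) ρ =
      fun i => ∫ z, g i z ∂(ρ.map F) := by
    ext i
    exact (hFm.integral_map _).symm
  let y₀ : Y := Classical.arbitrary Y
  have hw : Measurable fun y => ENNReal.ofReal (dist y y₀ ^ p) := by fun_prop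
  have hcomap : Measurable fun m : ProbabilityMeasure (ℕ → unitInterval) =>
      (m : Measure (ℕ → unitInterval)).comap F := by
    refine Measure.measurable_of_measurable_coe _ fun s hs => ?_
    simp_rw [hFm.comap_apply]
    exact (Measure.measurable_coe (hFm.measurableSet_image.2 hs)).comp measurable_subtype_coe
  let G : Set (ProbabilityMeasure (ℕ → unitInterval)) :=
    {m | (m : Measure (ℕ → unitInterval)) (range F)ᶜ = 0 ∧
      ∫⁻ y, ENNReal.ofReal (dist y y₀ ^ p) ∂((m : Measure (ℕ → unitInterval)).comap F) < ⊤}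
  have hG : MeasurableSet G :=
    ((Measure.measurable_coe hFm.measurableSet_range.compl).comp measurable_subtype_coe
      (measurableSet_singleton 0)).inter
      (((Measure.measurable_lintegral hw).comp hcomap) measurableSet_Iio)
  classical
  let Q₀ : ProbabilityMeasure (ℕ → unitInterval) → Measure Y := fun m =>
    if m ∈ G then (m : Measure (ℕ → unitInterval)).comap F else Measure.dirac y₀
  have hQ₀m : Measurable Q₀ := Measurable.ite hG hcomap measurable_const
  have hQ₀ (m) : IsProbabilityMeasure (Q₀ m) ∧ HasMomentPY p (Q₀ m) := by
    by_cases hm : m ∈ G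
    · have hP : IsProbabilityMeasure ((m : Measure (ℕ → unitInterval)).comap F) :=
        ⟨by
          rw [hFm.comap_apply, image_univ,
            prob_compl_eq_zero_iff hFm.measurableSet_range |>.1 hm.1]⟩
      simp only [Q₀, if_pos hm]
      exact ⟨hP, hasMomentPY_of_lintegral_ne_top hp hm.2.ne⟩
    · simp only [Q₀, if_neg hm]
      exact ⟨inferInstance, hasMomentPY_dirac y₀⟩
  let Q : ProbabilityMeasure (ℕ → unitInterval) → PpY p Y := fun m => ⟨Q₀ m, hQ₀ m⟩
  have hQm : Measurable Q := hQ₀m.subtype_mk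
  have hQG (m) (hm : m ∈ G) : (Q m).1.map F = m := by
    simp only [Q, Q₀, if_pos hm, hFm.map_comap]
    exact Measure.restrict_eq_self_of_ae_mem (measure_eq_zero_iff_ae_notMem.1 hm.1 |>.mono
      fun z hz => not_not.1 hz)
  have hdec (ρ : PpY p Y) : Q (R (integralSeq (fun i => g i ∘ F) ρ.1)) = ρ := by
    have := hmapP ρ.1
    have hR' := hRg ⟨ρ.1.map F, this⟩
    simp only [ProbabilityMeasure.coe_mk] at hR'
    rw [hmap, hR']
    have hm : (⟨ρ.1.map F, this⟩ : ProbabilityMeasure (ℕ → unitInterval)) ∈ G := by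
      refine ⟨?_, ?_⟩
      · change ρ.1.map F _ = 0
        rw [Measure.map_apply hFm.measurable hFm.measurableSet_range.compl]
        simp
      · change ∫⁻ y, _ ∂((ρ.1.map F).comap F) < ⊤
        rw [hFm.comap_map]
        exact (ρ.2.2 y₀).lt_top
    refine Subtype.ext ?_
    exact (if_pos hm).trans (hFm.comap_map _)
  refine ⟨⟨fun i => g i ∘ F, fun i => (g i).continuous.comp hF.continuous,
    fun i y => hg1 i _, ?_, Q ∘ R, hQm.comp hR, hdec, ?_⟩⟩
  · intro ρ ρs hρ hρs hlim U hU
    obtain ⟨V, hV, rfl⟩ := hF.isOpen_iff.1 hU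
    have hm := hmapP ρ
    have hms (k) := hmapP (ρs k)
    simp_rw [hmap] at hlim
    let m : ProbabilityMeasure (ℕ → unitInterval) := ⟨ρ.map F, hm⟩
    let ms (k : ℕ) : ProbabilityMeasure (ℕ → unitInterval) := ⟨(ρs k).map F, hms k⟩
    have : Tendsto ms atTop (𝓝 m) :=
      (isClosedEmbedding_integral hginj).isInducing.tendsto_nhds_iff.2 hlim
    have h := ProbabilityMeasure.le_liminf_measure_open_of_tendsto this hV
    simpa [m, ms, Measure.map_apply hFm.measurable hV.measurableSet] using h
  · intro X _ μ hμ κ hκ v hv hlim ν hν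
    have hcl := (isClosedEmbedding_integral hginj).isClosed_range
    have hRv : ∀ᵐ x ∂μ, (fun i => ∫ z, g i z ∂(R (v x) : Measure (ℕ → unitInterval))) = v x := by
      filter_upwards [hlim] with x hx
      have : v x ∈ range fun (m : ProbabilityMeasure (ℕ → unitInterval)) i =>
          ∫ x, g i x ∂(m : Measure (ℕ → unitInterval)) :=
        hcl.mem_of_tendsto hx (.of_forall fun k =>
          ⟨⟨(κ k x).1.map F, hmapP _⟩, (hmap (κ k x).1).symm⟩)
      obtain ⟨m, hm⟩ := this
      rw [← hm, hRg]
    have hRvm : Measurable fun x => (R (v x) : Measure (ℕ → unitInterval)) :=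
      measurable_subtype_coe.comp (hR.comp hv)
    have hbP := isProbabilityMeasure_bind_of_measurable (μ := μ) hRvm fun x => inferInstance
    have hνP := hmapP ν.1
    have hbind : μ.bind (fun x => (R (v x) : Measure (ℕ → unitInterval))) = ν.1.map F := by
      have := @hginj ⟨_, hbP⟩ ⟨_, hνP⟩ ?_
      · exact congrArg Subtype.val this
      ext i
      change ∫ z, g i z ∂(μ.bind _) = ∫ z, g i z ∂(ν.1.map F)
      rw [integral_bind_of_integrable hRvm
        (integrable_of_abs_le_one (g i).continuous.measurable (hg1 i)), hFm.integral_map]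
      refine tendsto_nhds_unique ?_ (hν i)
      refine tendsto_integral_of_dominated_convergence (fun _ => 1) (fun k => ?_)
        (integrable_const _) (fun k => .of_forall fun x => ?_) ?_
      · exact ((measurable_integral_measure ((g i).continuous.comp hF.continuous).measurable).comp
          (measurable_subtype_coe.comp (hκ k))).aestronglyMeasurable
      · exact abs_integral_le_one fun y => hg1 i _
      · filter_upwards [hlim, hRv] with x hx hx'
        rw [congrFun hx' i]
        exact tendsto_pi_nhds.1 hx i
    have hgood : ∀ᵐ x ∂μ, R (v x) ∈ G := by
      have h1 : ∀ᵐ x ∂μ, (R (v x) : Measure (ℕ → unitInterval)) (range F)ᶜ = 0 := by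
        have : (ν.1.map F) (range F)ᶜ = 0 := by
          rw [Measure.map_apply hFm.measurable hFm.measurableSet_range.compl]
          simp
        rw [← hbind, Measure.bind_apply hFm.measurableSet_range.compl hRvm.aemeasurable] at this
        exact (lintegral_eq_zero_iff
          ((Measure.measurable_coe hFm.measurableSet_range.compl).comp hRvm)).1 this
      have hcm : Measurable fun x => (R (v x) : Measure (ℕ → unitInterval)).comap F :=
        hcomap.comp (hR.comp hv)
      have h2 : μ.bind (fun x => (R (v x) : Measure (ℕ → unitInterval)).comap F) = ν.1 := by
        rw [← hFm.comap_map ν.1, ← hbind]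
        ext s hs
        rw [hFm.comap_apply, Measure.bind_apply hs hcm.aemeasurable,
          Measure.bind_apply (hFm.measurableSet_image.2 hs) hRvm.aemeasurable]
        simp_rw [hFm.comap_apply]
      have h3 := ν.2.2 y₀
      rw [← h2, Measure.lintegral_bind hcm.aemeasurable hw.aemeasurable] at h3
      filter_upwards [h1, ae_lt_top ((Measure.measurable_lintegral hw).comp hcm) h3] with x hx hx'
      exact ⟨hx, hx'⟩
    filter_upwards [hgood, hRv] with x hx hx'
    rw [hmap, Function.comp_apply, hQG _ hx, hx']

end Decode

section TestSequence

variable {p : ℝ} {Y : Type*} [MetricSpace Y] [MeasurableSpace Y]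

/-- The `p`-th moment around `y₀`. -/
noncomputable def pMoment (p : ℝ) (y₀ : Y) (ρ : Measure Y) : ℝ≥0∞ :=
  ∫⁻ y, ENNReal.ofReal (dist y y₀ ^ p) ∂ρ

lemma pMoment_ne_top (y₀ : Y) (ρ : PpY p Y) : pMoment p y₀ ρ.1 ≠ ⊤ := ρ.2.2 y₀

lemma measurable_pMoment [BorelSpace Y] (y₀ : Y) :
    Measurable fun ρ : Measure Y => pMoment p y₀ ρ := by
  have : Measurable fun y => ENNReal.ofReal (dist y y₀ ^ p) := by fun_prop
  exact Measure.measurable_lintegral this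

lemma continuous_dist_rpow {p : ℝ} {Y : Type*} [MetricSpace Y] (hp : 0 ≤ p) (y₀ : Y) :
    Continuous fun y => dist y y₀ ^ p :=
  (continuous_id.dist continuous_const).rpow_const fun _ => Or.inr hp

lemma exists_growth_bound {p : ℝ} {Y : Type*} [MetricSpace Y] (hp : 0 ≤ p) {f : Y → ℝ}
    {K : ℝ} {y₁ : Y}
    (h : ∀ y, |f y| ≤ K * (1 + dist y y₁ ^ p)) (y₀ : Y) :
    ∃ K' : ℝ, 0 ≤ K' ∧ ∀ y, |f y| ≤ K' * (1 + dist y y₀ ^ p) := by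
  have hK : 0 ≤ K := by
    have := (abs_nonneg _).trans (h y₁)
    exact nonneg_of_mul_nonneg_left this (by positivity)
  refine ⟨K * (1 + 2 ^ p * (1 + dist y₀ y₁ ^ p)), by positivity, fun y => (h y).trans ?_⟩
  rw [mul_assoc]
  refine mul_le_mul_of_nonneg_left ?_ hK
  have h1 := dist_rpow_le hp y y₀ y₁
  have h2 : (0 : ℝ) ≤ dist y y₀ ^ p := by positivity
  have h3 : (0 : ℝ) ≤ dist y₀ y₁ ^ p := by positivity
  have h4 : (0 : ℝ) ≤ 2 ^ p := by positivity
  nlinarith [mul_nonneg h4 h2, mul_nonneg h4 h3, mul_nonneg (mul_nonneg h4 h2) h3]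

lemma integrable_dist_rpow [BorelSpace Y] (y₀ : Y) (ρ : PpY p Y) :
    Integrable (fun y => dist y y₀ ^ p) ρ.1 := by
  refine ⟨(by fun_prop : Measurable fun y => dist y y₀ ^ p).aestronglyMeasurable, ?_⟩
  rw [hasFiniteIntegral_iff_ofReal (.of_forall fun y => by positivity)]
  exact (ρ.2.2 y₀).lt_top

lemma integrable_of_growth [BorelSpace Y] {f : Y → ℝ} (hf : Measurable f)
    {K : ℝ} {y₁ : Y} (h : ∀ y, |f y| ≤ K * (1 + dist y y₁ ^ p)) (ρ : PpY p Y) :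
    Integrable f ρ.1 :=
  (((integrable_const 1).add (integrable_dist_rpow y₁ ρ)).const_mul K).mono'
    hf.aestronglyMeasurable (.of_forall h)

lemma ofReal_integral_dist_rpow [BorelSpace Y] (y₀ : Y) (ρ : PpY p Y) :
    ENNReal.ofReal (∫ y, dist y y₀ ^ p ∂ρ.1) = pMoment p y₀ ρ.1 :=
  ofReal_integral_eq_lintegral_ofReal (integrable_dist_rpow y₀ ρ)
    (.of_forall fun y => by positivity)

namespace TestSequence

variable (T : TestSequence p Y)

lemma lintegral_le_liminf [BorelSpace Y] {ρ : PpY p Y} {ρs : ℕ → PpY p Y}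
    (h : Tendsto (fun k => integralSeq T.φ (ρs k).1) atTop (𝓝 (integralSeq T.φ ρ.1)))
    {f : Y → ℝ} (hf : Continuous f) (hf0 : 0 ≤ f) :
    ∫⁻ y, ENNReal.ofReal (f y) ∂ρ.1 ≤
      liminf (fun k => ∫⁻ y, ENNReal.ofReal (f y) ∂(ρs k).1) atTop :=
  lintegral_le_liminf_lintegral_of_forall_isOpen_measure_le_liminf_measure hf hf0
    (T.tendsto_measure_of_isOpen _ _ inferInstance (fun _ => inferInstance) h)

lemma eventually_lt_integral [BorelSpace Y] {ρ : PpY p Y} {ρs : ℕ → PpY p Y}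
    (h : Tendsto (fun k => integralSeq T.φ (ρs k).1) atTop (𝓝 (integralSeq T.φ ρ.1)))
    {f : Y → ℝ} (hf : Continuous f) (hf0 : ∀ y, 0 ≤ f y)
    (hi : ∀ ρ : PpY p Y, Integrable f ρ.1) {c : ℝ} (hc : c < ∫ y, f y ∂ρ.1) :
    ∀ᶠ k in atTop, c < ∫ y, f y ∂(ρs k).1 := by
  rcases lt_or_ge c 0 with hc0 | hc0
  · exact .of_forall fun k => hc0.trans_le (integral_nonneg hf0)
  · have h1 := T.lintegral_le_liminf h hf hf0
    rw [← ofReal_integral_eq_lintegral_ofReal (hi ρ) (.of_forall hf0)] at h1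
    have h2 := ((ENNReal.ofReal_lt_ofReal_iff (hc0.trans_lt hc)).2 hc).trans_le h1
    filter_upwards [eventually_lt_of_lt_liminf h2] with k hk
    rw [← ofReal_integral_eq_lintegral_ofReal (hi _) (.of_forall hf0)] at hk
    exact ENNReal.ofReal_lt_ofReal_iff'.1 hk |>.1

lemma tendsto_of_tendsto_integralSeq [BorelSpace Y] (hp : 0 ≤ p) {y₀ : Y} {ρ : PpY p Y}
    {ρs : ℕ → PpY p Y}
    (h : Tendsto (fun k => integralSeq T.φ (ρs k).1) atTop (𝓝 (integralSeq T.φ ρ.1)))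
    (hw : Tendsto (fun k => pMoment p y₀ (ρs k).1) atTop (𝓝 (pMoment p y₀ ρ.1))) :
    Tendsto ρs atTop (𝓝 ρ) := by
  rw [nhds_iInf, tendsto_iInf]
  rintro ⟨f, hf, K₀, y₁, hK₀⟩
  rw [nhds_induced, tendsto_comap_iff]
  obtain ⟨K, hK0, hK⟩ := exists_growth_bound hp hK₀ y₀
  have hw' : Tendsto (fun k => ∫ y, dist y y₀ ^ p ∂(ρs k).1) atTop
      (𝓝 (∫ y, dist y y₀ ^ p ∂ρ.1)) := by
    have := (ENNReal.tendsto_toReal (pMoment_ne_top y₀ ρ)).comp hw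
    have h0 (ρ : PpY p Y) : (pMoment p y₀ ρ.1).toReal = ∫ y, dist y y₀ ^ p ∂ρ.1 := by
      rw [← ofReal_integral_dist_rpow,
        ENNReal.toReal_ofReal (integral_nonneg fun y => by positivity)]
    simpa only [Function.comp_def, h0] using this
  have hfi (ρ : PpY p Y) : Integrable f ρ.1 := integrable_of_growth hf.measurable hK ρ
  have hKi (ρ : PpY p Y) : Integrable (fun y => K * (1 + dist y y₀ ^ p)) ρ.1 :=
    ((integrable_const 1).add (integrable_dist_rpow y₀ ρ)).const_mul K
  have hKe (ρ : PpY p Y) : ∫ y, K * (1 + dist y y₀ ^ p) ∂ρ.1 =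
      K * (1 + ∫ y, dist y y₀ ^ p ∂ρ.1) := by
    rw [integral_const_mul, integral_add (integrable_const 1) (integrable_dist_rpow y₀ ρ)]
    simp
  have hlimK : Tendsto (fun k => ∫ y, K * (1 + dist y y₀ ^ p) ∂(ρs k).1) atTop
      (𝓝 (∫ y, K * (1 + dist y y₀ ^ p) ∂ρ.1)) := by
    simp_rw [hKe]
    exact (hw'.const_add 1).const_mul K
  have hcK : Continuous fun y => K * (1 + dist y y₀ ^ p) :=
    continuous_const.mul (continuous_const.add (continuous_dist_rpow hp y₀))
  refine tendsto_order.2 ⟨fun c hc => ?_, fun c hc => ?_⟩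
  · have h1 := T.eventually_lt_integral h (hcK.add hf)
      (fun y => by have := abs_le.1 (hK y); simp only [Pi.add_apply]; linarith)
      (fun ρ => (hKi ρ).add (hfi ρ))
      (c := ∫ y, K * (1 + dist y y₀ ^ p) ∂ρ.1 + (c + ∫ y, f y ∂ρ.1) / 2)
      (by rw [integral_add' (hKi ρ) (hfi ρ)]; linarith)
    have h2 := hlimK.eventually_lt_const (u := ∫ y, K * (1 + dist y y₀ ^ p) ∂ρ.1 +
      (∫ y, f y ∂ρ.1 - c) / 2) (by linarith)
    filter_upwards [h1, h2] with k h1 h2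
    rw [integral_add' (hKi _) (hfi _)] at h1
    simp only [Function.comp_apply]
    linarith
  · have h1 := T.eventually_lt_integral h (hcK.sub hf)
      (fun y => by have := abs_le.1 (hK y); simp only [Pi.sub_apply]; linarith)
      (fun ρ => (hKi ρ).sub (hfi ρ))
      (c := ∫ y, K * (1 + dist y y₀ ^ p) ∂ρ.1 - (c + ∫ y, f y ∂ρ.1) / 2)
      (by rw [integral_sub' (hKi ρ) (hfi ρ)]; linarith)
    have h2 := hlimK.eventually_lt_const (u := ∫ y, K * (1 + dist y y₀ ^ p) ∂ρ.1 +
      (c - ∫ y, f y ∂ρ.1) / 2) (by linarith)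
    filter_upwards [h1, h2] with k h1 h2
    rw [integral_sub' (hKi _) (hfi _)] at h1
    simp only [Function.comp_apply]
    linarith

lemma isInducing_integralSeq [BorelSpace Y] (hp : 0 ≤ p) (y₀ : Y) :
    IsInducing fun ρ : PpY p Y => (integralSeq T.φ ρ.1, pMoment p y₀ ρ.1) := by
  have hcont {f : Y → ℝ} (hf : GrowthPY p f) : Continuous fun ρ : PpY p Y => ∫ y, f y ∂ρ.1 :=
    continuous_iInf_dom (i := (⟨f, hf⟩ : {f : Y → ℝ // GrowthPY p f})) continuous_induced_dom
  have hc : Continuous fun ρ : PpY p Y => (integralSeq T.φ ρ.1, pMoment p y₀ ρ.1) := by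
    refine .prodMk (continuous_pi fun i => hcont ⟨T.continuous i, 1, y₀, fun y => ?_⟩) ?_
    · have : (0 : ℝ) ≤ dist y y₀ ^ p := by positivity
      linarith [T.abs_le_one i y]
    · simp_rw [← ofReal_integral_dist_rpow]
      refine ENNReal.continuous_ofReal.comp (hcont ⟨continuous_dist_rpow hp y₀, 1, y₀, fun y => ?_⟩)
      rw [abs_of_nonneg (by positivity)]
      linarith
  refine isInducing_iff_nhds.2 fun ρ => le_antisymm hc.continuousAt.le_comap ?_
  refine tendsto_id'.1 (tendsto_of_seq_tendsto fun u hu => ?_)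
  have hu' := tendsto_comap_iff.1 hu
  rw [nhds_prod_eq] at hu'
  exact T.tendsto_of_tendsto_integralSeq hp hu'.fst hu'.snd

lemma measurable_integralSeq [BorelSpace Y] :
    Measurable fun ρ : Measure Y => integralSeq T.φ ρ :=
  measurable_pi_iff.2 fun i => measurable_integral_measure (T.continuous i).measurable

lemma measurable_of_lowerSemicontinuous (T : TestSequence p Y) [BorelSpace Y] (hp : 0 ≤ p)
    (y₀ : Y) {X : Type*}
    [TopologicalSpace X] [SecondCountableTopology X] [MeasurableSpace X] [BorelSpace X]
    {f : X × PpY p Y → ℝ≥0∞} (hf : LowerSemicontinuous f) : Measurable f := by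
  refine measurable_of_Ioi fun c => ?_
  obtain ⟨V, hV, h⟩ := (IsInducing.id.prodMap (T.isInducing_integralSeq hp y₀)).isOpen_iff.1
    (hf.isOpen_preimage c)
  rw [← h]
  refine Measurable.prodMap measurable_id ?_ hV.measurableSet
  exact (T.measurable_integralSeq.comp measurable_subtype_coe).prodMk
    ((measurable_pMoment y₀).comp measurable_subtype_coe)

end TestSequence

end TestSequence

/-- **Measurable almost-minimizers**: over a parameter set which is a measurable image of a Polish
space, the infimum of a jointly measurable function is attained up to `ε` by a measurable map. -/
lemma exists_measurable_almost_minimizer {X Z P : Type*} [TopologicalSpace X] [PolishSpace X]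
    [MeasurableSpace X] [BorelSpace X] (μ : Measure X) [IsFiniteMeasure μ]
    [TopologicalSpace Z] [PolishSpace Z] [MeasurableSpace Z] [BorelSpace Z] [Nonempty Z]
    [MeasurableSpace P] {θ : Z → P} (hθ : Measurable θ) (hsurj : Function.Surjective θ)
    {Φ : X × P → ℝ≥0∞} (hΦ : Measurable Φ) {ε : ℝ≥0∞} (hε : ε ≠ 0) :
    ∃ κ : X → P, Measurable κ ∧ ∀ᵐ x ∂μ, Φ (x, κ x) ≤ (⨅ q, Φ (x, q)) + ε := by
  have hB (n : ℕ) : MeasurableSet {a : X × Z | Φ (a.1, θ a.2) < n * ε} :=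
    measurableSet_lt (hΦ.comp (measurable_fst.prodMk (hθ.comp measurable_snd))) measurable_const
  choose s hs hsB using fun n => exists_measurable_selection μ (hB n)
  simp only [Set.mem_ofPred_eq] at hsB
  let q : ℕ → X → Prop := fun n x =>
    Φ (x, θ (s n x)) < n * ε ∨ ∀ m : ℕ, ¬ Φ (x, θ (s m x)) < m * ε
  have hm (n : ℕ) : MeasurableSet {x | Φ (x, θ (s n x)) < n * ε} :=
    measurableSet_lt (hΦ.comp (measurable_id.prodMk (hθ.comp (hs n)))) measurable_const
  have hq (n : ℕ) : MeasurableSet {x | q n x} := by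
    have : MeasurableSet {x | ∀ m : ℕ, ¬ Φ (x, θ (s m x)) < m * ε} := by
      rw [ofPred_forall]
      exact .iInter fun m => (hm m).compl
    exact (hm n).union this
  have hex (x : X) : ∃ n, q n x := by
    by_cases h : ∃ m : ℕ, Φ (x, θ (s m x)) < m * ε
    · exact h.imp fun m hm => Or.inl hm
    · exact ⟨0, Or.inr (not_exists.1 h)⟩
  classical
  refine ⟨fun x => θ (s (Nat.find (hex x)) x), hθ.comp (Measurable.find hs hq hex), ?_⟩
  filter_upwards [ae_all_iff.2 hsB] with x hx
  rcases eq_or_ne (⨅ q, Φ (x, q)) ⊤ with hI | hI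
  · simp [hI]
  rcases eq_or_ne ε ⊤ with hεt | hεt
  · simp [hεt]
  have hex' : ∃ n : ℕ, ⨅ q, Φ (x, q) < n * ε := by
    obtain ⟨n, hn⟩ := ENNReal.exists_nat_mul_gt hε hI
    exact ⟨n, hn⟩
  set n₀ := Nat.find hex' with hn₀
  have h₀ : ⨅ q, Φ (x, q) < n₀ * ε := Nat.find_spec hex'
  have hpos : n₀ ≠ 0 := fun h => by simp [h] at h₀
  obtain ⟨k, hk⟩ := Nat.exists_eq_succ_of_ne_zero hpos
  have h₁ : k * ε ≤ ⨅ q, Φ (x, q) :=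
    not_lt.1 (Nat.find_min hex' (m := k) (by omega))
  obtain ⟨ρ, hρ⟩ := iInf_lt_iff.1 h₀
  obtain ⟨z, rfl⟩ := hsurj ρ
  have h₂ := hx n₀ ⟨z, hρ⟩
  have hle : Nat.find (hex x) ≤ n₀ := Nat.find_min' _ (Or.inl h₂)
  have h₃ := (Nat.find_spec (hex x)).resolve_right fun h => h _ h₂
  calc Φ (x, θ (s (Nat.find (hex x)) x)) ≤ Nat.find (hex x) * ε := h₃.le
    _ ≤ n₀ * ε := by gcongr
    _ = k * ε + ε := by rw [hk]; push_cast; ring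
    _ ≤ _ := by gcongr

/-- Almost minimal-norm elements of a bounded decreasing sequence of nonempty convex sets of a
Hilbert space converge. -/
lemma exists_tendsto_of_antitone_convex {H : Type*} [NormedAddCommGroup H] [InnerProductSpace ℝ H]
    [CompleteSpace H] {A : ℕ → Set H} (hA : Antitone A) (hne : ∀ n, (A n).Nonempty)
    (hconv : ∀ n, Convex ℝ (A n)) {R : ℝ} (hR : ∀ n, ∀ v ∈ A n, ‖v‖ ≤ R) :
    ∃ v : ℕ → H, (∀ n, v n ∈ A n) ∧ ∃ a, Tendsto v atTop (𝓝 a) := by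
  let d : ℕ → ℝ := fun n => sInf (norm '' A n)
  have hbdd (n) : BddBelow (norm '' A n) := ⟨0, by rintro _ ⟨v, -, rfl⟩; exact norm_nonneg v⟩
  have hd_le (n) (v) (hv : v ∈ A n) : d n ≤ ‖v‖ := csInf_le (hbdd n) ⟨v, hv, rfl⟩
  have hd0 (n) : 0 ≤ d n :=
    le_csInf ((hne n).image _) (by rintro _ ⟨v, -, rfl⟩; exact norm_nonneg v)
  have hdR (n) : d n ≤ R := by
    obtain ⟨v, hv⟩ := hne n
    exact (hd_le n v hv).trans (hR n v hv)
  have hmono : Monotone d := fun m n hmn =>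
    csInf_le_csInf (hbdd m) ((hne n).image _) (image_mono (hA hmn))
  have hlim := tendsto_atTop_ciSup hmono ⟨R, by rintro _ ⟨n, rfl⟩; exact hdR n⟩
  set D := ⨆ n, d n
  have hdD (n) : d n ≤ D := le_ciSup (f := d) ⟨R, by rintro _ ⟨n, rfl⟩; exact hdR n⟩ n
  have hex (n : ℕ) : ∃ v ∈ A n, ‖v‖ < d n + 1 / ((n : ℝ) + 1) := by
    obtain ⟨_, ⟨v, hv, rfl⟩, h⟩ := exists_lt_of_csInf_lt ((hne n).image norm)
      (lt_add_of_pos_right (d n) (Nat.one_div_pos_of_nat (α := ℝ) (n := n)))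
    exact ⟨v, hv, h⟩
  choose v hvA hv using hex
  refine ⟨v, hvA, cauchySeq_tendsto_of_complete (cauchySeq_of_le_tendsto_0'
    (fun n => √(4 * ((D + 1 / ((n : ℝ) + 1)) ^ 2 - d n ^ 2))) (fun n m hnm => ?_) ?_)⟩
  · have h1 : ‖v n‖ ≤ D + 1 / ((n : ℝ) + 1) := by linarith [hv n, hdD n]
    have h2 : ‖v m‖ ≤ D + 1 / ((n : ℝ) + 1) := by
      have : 1 / ((m : ℝ) + 1) ≤ 1 / ((n : ℝ) + 1) := by gcongr
      linarith [hv m, hdD m]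
    have h3 : d n ≤ ‖(1 / 2 : ℝ) • v n + (1 / 2 : ℝ) • v m‖ :=
      hd_le n _ (hconv n (hvA n) (hA hnm (hvA m)) (by norm_num) (by norm_num) (by norm_num))
    rw [← smul_add, norm_smul, Real.norm_of_nonneg (by norm_num)] at h3
    have h4 := parallelogram_law_with_norm ℝ (v n) (v m)
    rw [dist_eq_norm]
    refine Real.le_sqrt_of_sq_le ?_
    have h5 := mul_self_le_mul_self (norm_nonneg _) h1
    have h6 := mul_self_le_mul_self (norm_nonneg _) h2
    have h7 := mul_self_le_mul_self (hd0 n) h3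
    nlinarith
  · have h1 : Tendsto (fun n : ℕ => D + 1 / ((n : ℝ) + 1)) atTop (𝓝 (D + 0)) :=
      tendsto_one_div_add_atTop_nhds_zero_nat.const_add D
    have h2 := (((h1.pow 2).sub (hlim.pow 2)).const_mul 4).sqrt
    simpa using h2

section Mix

variable {p : ℝ} {Y : Type*} [MetricSpace Y] [MeasurableSpace Y]

/-- Convex combinations in `P_p(Y)`. -/
noncomputable def PpY.mix (t : ℝ≥0∞) (ht : t ≤ 1) (ρ₁ ρ₂ : PpY p Y) : PpY p Y :=
  ⟨t • ρ₁.1 + (1 - t) • ρ₂.1, ⟨by simp [add_tsub_cancel_of_le ht]⟩, fun y₀ => by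
    have h1 : t ≠ ⊤ := ne_top_of_le_ne_top ENNReal.one_ne_top ht
    have h2 : 1 - t ≠ ⊤ := ne_top_of_le_ne_top ENNReal.one_ne_top tsub_le_self
    rw [lintegral_add_measure, lintegral_smul_measure, lintegral_smul_measure]
    exact ENNReal.add_ne_top.2
      ⟨ENNReal.mul_ne_top h1 (ρ₁.2.2 y₀), ENNReal.mul_ne_top h2 (ρ₂.2.2 y₀)⟩⟩

lemma PpY.integral_mix {t : ℝ≥0∞} (ht : t ≤ 1) (ρ₁ ρ₂ : PpY p Y) {f : Y → ℝ}
    (h₁ : Integrable f ρ₁.1) (h₂ : Integrable f ρ₂.1) :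
    ∫ y, f y ∂(PpY.mix t ht ρ₁ ρ₂).1 =
      t.toReal * ∫ y, f y ∂ρ₁.1 + (1 - t).toReal * ∫ y, f y ∂ρ₂.1 := by
  have h1 : t ≠ ⊤ := ne_top_of_le_ne_top ENNReal.one_ne_top ht
  have h2 : 1 - t ≠ ⊤ := ne_top_of_le_ne_top ENNReal.one_ne_top tsub_le_self
  rw [PpY.mix, integral_add_measure (h₁.smul_measure h1) (h₂.smul_measure h2),
    integral_smul_measure, integral_smul_measure, smul_eq_mul, smul_eq_mul]

lemma PpY.lintegral_mix {t : ℝ≥0∞} (ht : t ≤ 1) (ρ₁ ρ₂ : PpY p Y) (f : Y → ℝ≥0∞) :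
    ∫⁻ y, f y ∂(PpY.mix t ht ρ₁ ρ₂).1 =
      t * ∫⁻ y, f y ∂ρ₁.1 + (1 - t) * ∫⁻ y, f y ∂ρ₂.1 := by
  rw [PpY.mix, lintegral_add_measure, lintegral_smul_measure, lintegral_smul_measure,
    smul_eq_mul, smul_eq_mul]

lemma PpY.measurable_mix {X : Type*} [MeasurableSpace X] {t : ℝ≥0∞} (ht : t ≤ 1)
    {κ₁ κ₂ : X → PpY p Y} (h₁ : Measurable κ₁) (h₂ : Measurable κ₂) :
    Measurable fun x => PpY.mix t ht (κ₁ x) (κ₂ x) := by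
  refine Measurable.subtype_mk (Measure.measurable_of_measurable_coe _ fun s hs => ?_)
  simp only [Measure.add_apply, Measure.smul_apply, smul_eq_mul]
  have hc {κ : X → PpY p Y} (h : Measurable κ) : Measurable fun x => (κ x).1 s :=
    (Measure.measurable_coe hs).comp (measurable_subtype_coe.comp h)
  exact ((hc h₁).const_mul t).add ((hc h₂).const_mul _)

end Mix

lemma TestSequence.exists_seq_ae_tendsto {p : ℝ} {Y : Type*} [MetricSpace Y] [MeasurableSpace Y]
    [BorelSpace Y] (T : TestSequence p Y) {X : Type*} [MeasurableSpace X] (μ : Measure X)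
    [IsProbabilityMeasure μ] {D : ℕ → Set (X → PpY p Y)} (hD : Antitone D)
    (hne : ∀ n, (D n).Nonempty) (hmeas : ∀ n, ∀ κ ∈ D n, Measurable κ)
    (hmix : ∀ n, ∀ κ₁ ∈ D n, ∀ κ₂ ∈ D n, ∀ t (ht : t ≤ 1),
      (fun x => PpY.mix t ht (κ₁ x) (κ₂ x)) ∈ D n) :
    ∃ κ : ℕ → X → PpY p Y, (∀ n, κ n ∈ D n) ∧ ∃ v : X → ℕ → ℝ, Measurable v ∧
      ∀ᵐ x ∂μ, Tendsto (fun k => integralSeq T.φ (κ k x).1) atTop (𝓝 (v x)) := by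
  let m : Measure ℕ := (Measure.count : Measure ℕ).toFinite
  let u : (X → PpY p Y) → X × ℕ → ℝ := fun κ a => integralSeq T.φ (κ a.1).1 a.2
  have hu1 (κ) (a) : ‖u κ a‖ ≤ 1 := abs_integral_le_one (T.abs_le_one a.2)
  have hum {κ : X → PpY p Y} (hκ : Measurable κ) : Measurable (u κ) :=
    measurable_from_prod_countable_left fun i => (measurable_integral_measure
      (T.continuous i).measurable).comp (measurable_subtype_coe.comp hκ)
  have huL {κ : X → PpY p Y} (hκ : Measurable κ) : MemLp (u κ) 2 (μ.prod m) :=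
    MemLp.of_bound (hum hκ).aestronglyMeasurable 1 (.of_forall (hu1 κ))
  let A : ℕ → Set (Lp ℝ 2 (μ.prod m)) := fun n => {f | ∃ κ ∈ D n, f =ᵐ[μ.prod m] u κ}
  have hmix' (n) (f) (hf : f ∈ A n) (g) (hg : g ∈ A n) (a b : ℝ) (ha : 0 ≤ a) (hb : 0 ≤ b)
      (hab : a + b = 1) : a • f + b • g ∈ A n := by
    obtain ⟨κ₁, h₁, hf⟩ := hf
    obtain ⟨κ₂, h₂, hg⟩ := hg
    have ht : ENNReal.ofReal a ≤ 1 := ENNReal.ofReal_le_one.2 (by linarith)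
    refine ⟨_, hmix n κ₁ h₁ κ₂ h₂ (ENNReal.ofReal a) ht, ?_⟩
    filter_upwards [hf, hg, Lp.coeFn_add (a • f) (b • g), Lp.coeFn_smul a f, Lp.coeFn_smul b g]
      with x h1 h2 h3 h4 h5
    have hi (ρ : PpY p Y) (i : ℕ) : Integrable (T.φ i) ρ.1 :=
      integrable_of_abs_le_one (T.continuous i).measurable (T.abs_le_one i)
    rw [h3, Pi.add_apply, h4, h5, Pi.smul_apply, Pi.smul_apply, h1, h2]
    simp only [u, integralSeq]
    rw [PpY.integral_mix ht _ _ (hi _ _) (hi _ _), ENNReal.toReal_sub_of_le ht ENNReal.one_ne_top,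
      ENNReal.toReal_ofReal ha, ENNReal.toReal_one, ← hab]
    simp
  obtain ⟨w, hwA, f, hwf⟩ := exists_tendsto_of_antitone_convex (A := A)
    (fun m n hmn f hf => by
      obtain ⟨κ, h, hf⟩ := hf
      exact ⟨κ, hD hmn h, hf⟩)
    (fun n => by
      obtain ⟨κ, h⟩ := hne n
      exact ⟨(huL (hmeas n κ h)).toLp _, κ, h, MemLp.coeFn_toLp _⟩)
    (fun n f hf g hg a b ha hb hab => hmix' n f hf g hg a b ha hb hab)
    (R := (measureUnivNNReal (μ.prod m) : ℝ) ^ (2 : ℝ≥0∞).toReal⁻¹ * 1)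
    (fun n f hf => by
      obtain ⟨κ, h, hf⟩ := hf
      refine Lp.norm_le_of_ae_bound zero_le_one ?_
      filter_upwards [hf] with a ha
      rw [ha]
      exact hu1 κ a)
  choose κ hκD hκ using hwA
  obtain ⟨ns, hns, hae⟩ :=
    (tendstoInMeasure_of_tendsto_Lp hwf).exists_seq_tendsto_ae
  refine ⟨fun k => κ (ns k), fun k => hD (hns.id_le k) (hκD _), fun x i => f (x, i), ?_, ?_⟩
  · exact measurable_pi_iff.2 fun i =>
      (Lp.stronglyMeasurable f).measurable.comp (measurable_id.prodMk measurable_const)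
  · have hae' := ae_all_iff.2 hκ
    have : ∀ᵐ a ∂(μ.prod m), Tendsto (fun k => u (κ (ns k)) a) atTop (𝓝 (f a)) := by
      filter_upwards [hae, hae'] with a h1 h2
      simpa only [h2] using h1
    filter_upwards [Measure.ae_ae_of_ae_prod this] with x hx
    refine tendsto_pi_nhds.2 fun i => ?_
    rw [ae_toFinite, Measure.ae_count_iff] at hx
    exact hx i

lemma exists_subseq_ae_tendsto_of_le_liminf {X : Type*} [MeasurableSpace X] {μ : Measure X}
    {a : X → ℝ≥0∞} {b : ℕ → X → ℝ≥0∞} (ha : Measurable a) (hb : ∀ k, Measurable (b k))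
    (hfin : ∫⁻ x, a x ∂μ ≠ ⊤) (hle : ∀ᵐ x ∂μ, a x ≤ liminf (fun k => b k x) atTop)
    {e : ℕ → ℝ≥0∞} (he : Tendsto e atTop (𝓝 (∫⁻ x, a x ∂μ)))
    (hbe : ∀ k, ∫⁻ x, b k x ∂μ ≤ e k) :
    ∃ n : ℕ → ℕ, StrictMono n ∧ ∀ᵐ x ∂μ, Tendsto (fun k => b (n k) x) atTop (𝓝 (a x)) := by
  have hmin : ∀ᵐ x ∂μ, Tendsto (fun k => min (b k x) (a x)) atTop (𝓝 (a x)) := by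
    filter_upwards [hle] with x hx
    refine tendsto_order.2 ⟨fun c hc => ?_, fun c hc => .of_forall fun k =>
      (min_le_right _ _).trans_lt hc⟩
    filter_upwards [eventually_lt_of_lt_liminf (hc.trans_le hx)] with k hk
    exact lt_min hk hc
  have hlint : Tendsto (fun k => ∫⁻ x, min (b k x) (a x) ∂μ) atTop (𝓝 (∫⁻ x, a x ∂μ)) :=
    tendsto_lintegral_of_dominated_convergence a (fun k => (hb k).min ha)
      (fun k => .of_forall fun x => min_le_right _ _) hfin hmin
  have hminfin (k) : ∫⁻ x, min (b k x) (a x) ∂μ ≠ ⊤ :=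
    ne_top_of_le_ne_top hfin (lintegral_mono fun x => min_le_right _ _)
  have hdiff : Tendsto (fun k => ∫⁻ x, (b k x - min (b k x) (a x)) ∂μ) atTop (𝓝 0) := by
    have h1 : Tendsto (fun k => e k - ∫⁻ x, min (b k x) (a x) ∂μ) atTop (𝓝 0) := by
      have := ENNReal.Tendsto.sub he hlint (Or.inl hfin)
      rwa [tsub_self] at this
    refine tendsto_of_tendsto_of_tendsto_of_le_of_le tendsto_const_nhds h1 (fun _ => zero_le)
      fun k => ?_
    change ∫⁻ x, (b k x - min (b k x) (a x)) ∂μ ≤ _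
    rw [lintegral_sub ((hb k).min ha) (hminfin k) (.of_forall fun x => min_le_left _ _)]
    exact tsub_le_tsub_right (hbe k) _
  obtain ⟨δ, hδ0, hδ⟩ := ENNReal.exists_pos_sum_of_countable' one_ne_zero ℕ
  obtain ⟨n, hn, hnδ⟩ := extraction_forall_of_eventually
    (fun k => hdiff.eventually_lt_const (hδ0 k))
  refine ⟨n, hn, ?_⟩
  have hm (k) : AEMeasurable (fun x => b (n k) x - min (b (n k) x) (a x)) μ :=
    ((hb _).sub ((hb _).min ha)).aemeasurable
  have hsum : ∫⁻ x, ∑' k, (b (n k) x - min (b (n k) x) (a x)) ∂μ ≠ ⊤ := by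
    rw [lintegral_tsum hm]
    exact ne_top_of_le_ne_top (hδ.trans ENNReal.one_lt_top).ne
      (ENNReal.tsum_le_tsum fun k => (hnδ k).le)
  filter_upwards [ae_lt_top' (.tsum hm) hsum, hmin] with x hx hx'
  have h0 := ENNReal.tendsto_atTop_zero_of_tsum_ne_top hx.ne
  have h1 := h0.add (hx'.comp hn.tendsto_atTop)
  rw [zero_add] at h1
  exact h1.congr fun k => tsub_add_cancel_of_le (min_le_left _ _)

lemma LowerSemicontinuous.le_liminf_of_tendsto {α : Type*} [TopologicalSpace α] {f : α → ℝ≥0∞}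
    (hf : LowerSemicontinuous f) {u : ℕ → α} {a : α} (hu : Tendsto u atTop (𝓝 a)) :
    f a ≤ liminf (fun k => f (u k)) atTop :=
  (hf.le_liminf a).trans (liminf_le_liminf_of_le (f := 𝓝 a) (g := map u atTop) hu)

section Closed

universe u v

variable {p : ℝ} {Y : Type u} [MetricSpace Y] [MeasurableSpace Y] [BorelSpace Y]
  {X : Type v} [MeasurableSpace X]

/-- Kernels which are admissible for the weak transport problem up to an error `1 / (n + 1)`. -/
def TestSequence.almostAdmissible (T : TestSequence.{u, v} p Y) (y₀ : Y) (μ : Measure X)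
    (ν : PpY p Y)
    (c : X → PpY p Y → ℝ≥0∞) (t : ℝ≥0∞) (n : ℕ) : Set (X → PpY p Y) :=
  {κ | Measurable κ ∧
    (∀ i < n, |∫ x, integralSeq T.φ (κ x).1 i ∂μ - ∫ y, T.φ i y ∂ν.1| ≤ 1 / ((n : ℝ) + 1)) ∧
    ∫⁻ x, pMoment p y₀ (κ x).1 ∂μ ≤ pMoment p y₀ ν.1 + ENNReal.ofReal (1 / ((n : ℝ) + 1)) ∧
    ∫⁻ x, c x (κ x) ∂μ ≤ t + ENNReal.ofReal (1 / ((n : ℝ) + 1))}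

lemma measurable_integralSeq_apply (T : TestSequence.{u, v} p Y) {κ : X → PpY p Y}
    (hκ : Measurable κ)
    (i : ℕ) : Measurable fun x => integralSeq T.φ (κ x).1 i :=
  (measurable_integral_measure (T.continuous i).measurable).comp (measurable_subtype_coe.comp hκ)

lemma integrable_integralSeq (T : TestSequence.{u, v} p Y) (μ : Measure X) [IsProbabilityMeasure μ]
    {κ : X → PpY p Y} (hκ : Measurable κ) (i : ℕ) :
    Integrable (fun x => integralSeq T.φ (κ x).1 i) μ :=
  integrable_of_abs_le_one (measurable_integralSeq_apply T hκ i) fun _ =>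
    abs_integral_le_one (T.abs_le_one i)

lemma measurable_pMoment_comp {y₀ : Y} {κ : X → PpY p Y} (hκ : Measurable κ) :
    Measurable fun x => pMoment p y₀ (κ x).1 :=
  (measurable_pMoment y₀).comp (measurable_subtype_coe.comp hκ)

lemma integral_integralSeq_mix (T : TestSequence.{u, v} p Y) (μ : Measure X)
    [IsProbabilityMeasure μ] {t : ℝ≥0∞} (ht : t ≤ 1) {κ₁ κ₂ : X → PpY p Y} (h₁ : Measurable κ₁)
    (h₂ : Measurable κ₂) (i : ℕ) :
    ∫ x, integralSeq T.φ (PpY.mix t ht (κ₁ x) (κ₂ x)).1 i ∂μ =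
      t.toReal * ∫ x, integralSeq T.φ (κ₁ x).1 i ∂μ +
        (1 - t.toReal) * ∫ x, integralSeq T.φ (κ₂ x).1 i ∂μ := by
  have hi (ρ : PpY p Y) : Integrable (T.φ i) ρ.1 :=
    integrable_of_abs_le_one (T.continuous i).measurable (T.abs_le_one i)
  rw [← integral_const_mul, ← integral_const_mul, ← integral_add
    ((integrable_integralSeq T μ h₁ i).const_mul _)
    ((integrable_integralSeq T μ h₂ i).const_mul _)]
  refine integral_congr_ae (.of_forall fun x => ?_)
  simp only [integralSeq]
  rw [PpY.integral_mix ht _ _ (hi _) (hi _),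
    ENNReal.toReal_sub_of_le ht ENNReal.one_ne_top, ENNReal.toReal_one]

lemma lintegral_le_of_le_mix {μ : Measure X} {t : ℝ≥0∞} (ht : t ≤ 1) {f g h : X → ℝ≥0∞}
    (hf : Measurable f) (hh : ∀ x, h x ≤ t * f x + (1 - t) * g x) :
    ∫⁻ x, h x ∂μ ≤ t * ∫⁻ x, f x ∂μ + (1 - t) * ∫⁻ x, g x ∂μ := by
  rw [← lintegral_const_mul' _ _ (ne_top_of_le_ne_top ENNReal.one_ne_top ht),
    ← lintegral_const_mul' _ _ (ne_top_of_le_ne_top ENNReal.one_ne_top tsub_le_self),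
    ← lintegral_add_left (hf.const_mul t)]
  exact lintegral_mono hh

/-- If there are almost admissible kernels up to every error, then there is an admissible one. -/
lemma TestSequence.exists_admissible (T : TestSequence.{u, v} p Y) (hp : 0 ≤ p) (y₀ : Y)
    [TopologicalSpace X] [SecondCountableTopology X] [BorelSpace X]
    (μ : Measure X) [IsProbabilityMeasure μ]
    (ν : PpY p Y) {c : X → PpY p Y → ℝ≥0∞}
    (hc : LowerSemicontinuous fun q : X × PpY p Y => c q.1 q.2)
    (hconv : ∀ x ρ₁ ρ₂ t (ht : t ≤ 1),
      c x (PpY.mix t ht ρ₁ ρ₂) ≤ t * c x ρ₁ + (1 - t) * c x ρ₂) {t₀ : ℝ≥0∞}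
    (hne : ∀ n, (T.almostAdmissible y₀ μ ν c t₀ n).Nonempty) :
    ∃ κ : X → PpY p Y, Measurable κ ∧ μ.bind (fun x => (κ x).1) = ν.1 ∧
      ∫⁻ x, c x (κ x) ∂μ ≤ t₀ := by
  have hcm : Measurable fun q : X × PpY p Y => c q.1 q.2 :=
    T.measurable_of_lowerSemicontinuous hp y₀ hc
  have hcκ {κ : X → PpY p Y} (hκ : Measurable κ) : Measurable fun x => c x (κ x) :=
    hcm.comp (measurable_id.prodMk hκ)
  have hmono : Antitone (T.almostAdmissible y₀ μ ν c t₀) := by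
    rintro m n hmn κ ⟨h1, h2, h3, h4⟩
    have h : 1 / ((n : ℝ) + 1) ≤ 1 / ((m : ℝ) + 1) := by gcongr
    refine ⟨h1, fun i hi => (h2 i (hi.trans_le hmn)).trans h, h3.trans ?_, h4.trans ?_⟩ <;>
      gcongr
  have hmixle {t e : ℝ≥0∞} (ht : t ≤ 1) {f g h : X → ℝ≥0∞} (hf : Measurable f)
      (hfe : ∫⁻ x, f x ∂μ ≤ e) (hge : ∫⁻ x, g x ∂μ ≤ e)
      (hh : ∀ x, h x ≤ t * f x + (1 - t) * g x) : ∫⁻ x, h x ∂μ ≤ e := by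
    calc ∫⁻ x, h x ∂μ ≤ t * ∫⁻ x, f x ∂μ + (1 - t) * ∫⁻ x, g x ∂μ :=
          lintegral_le_of_le_mix ht hf hh
      _ ≤ t * e + (1 - t) * e := by gcongr
      _ = e := by rw [← add_mul, add_tsub_cancel_of_le ht, one_mul]
  obtain ⟨κ, hκ, v, hv, hlim⟩ := T.exists_seq_ae_tendsto μ hmono hne (fun n κ h => h.1) (by
    rintro n κ₁ ⟨h1, h2, h3, h4⟩ κ₂ ⟨k1, k2, k3, k4⟩ t ht
    refine ⟨PpY.measurable_mix ht h1 k1, fun i hi => ?_,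
      hmixle ht (measurable_pMoment_comp h1) h3 k3 fun x => (PpY.lintegral_mix ht _ _ _).le,
      hmixle ht (hcκ h1) h4 k4 fun x => hconv _ _ _ _ _⟩
    have h5 := abs_le.1 (h2 i hi)
    have h6 := abs_le.1 (k2 i hi)
    have ht1 : t.toReal ≤ 1 := by simpa using ENNReal.toReal_mono ENNReal.one_ne_top ht
    have ht0 : 0 ≤ t.toReal := ENNReal.toReal_nonneg
    rw [integral_integralSeq_mix T μ ht h1 k1, abs_le]
    constructor <;> nlinarith)
  have hκm (k) : Measurable (κ k) := (hκ k).1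
  have hν (i) : Tendsto (fun k => ∫ x, integralSeq T.φ (κ k x).1 i ∂μ) atTop
      (𝓝 (∫ y, T.φ i y ∂ν.1)) := by
    refine tendsto_iff_dist_tendsto_zero.2 (squeeze_zero' (.of_forall fun _ => dist_nonneg) ?_
      (tendsto_one_div_add_atTop_nhds_zero_nat (𝕜 := ℝ)))
    filter_upwards [eventually_gt_atTop i] with k hk using (hκ k).2.1 i hk
  have hdec := T.integralSeq_decode_ae μ inferInstance κ hκm v hv hlim ν hν
  let κ' : X → PpY p Y := fun x => T.decode (v x)
  have hκ'm : Measurable κ' := T.measurable_decode.comp hv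
  have hκ'v : Measurable fun x => (κ' x).1 := measurable_subtype_coe.comp hκ'm
  have hlim' : ∀ᵐ x ∂μ, Tendsto (fun k => integralSeq T.φ (κ k x).1) atTop
      (𝓝 (integralSeq T.φ (κ' x).1)) := by
    filter_upwards [hlim, hdec] with x h1 h2
    rwa [h2]
  have herr : Tendsto (fun k : ℕ => ENNReal.ofReal (1 / ((k : ℝ) + 1))) atTop (𝓝 0) := by
    simpa using ENNReal.tendsto_ofReal (tendsto_one_div_add_atTop_nhds_zero_nat (𝕜 := ℝ))
  have herrM : Tendsto (fun k : ℕ => pMoment p y₀ ν.1 + ENNReal.ofReal (1 / ((k : ℝ) + 1))) atTop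
      (𝓝 (pMoment p y₀ ν.1)) := by
    simpa using herr.const_add (pMoment p y₀ ν.1)
  have hwle : ∀ᵐ x ∂μ, pMoment p y₀ (κ' x).1 ≤
      liminf (fun k => pMoment p y₀ (κ k x).1) atTop := by
    filter_upwards [hlim'] with x hx
    exact T.lintegral_le_liminf hx (continuous_dist_rpow hp y₀) fun y => by
      simp only [Pi.zero_apply]; positivity
  have hMle : ∫⁻ x, pMoment p y₀ (κ' x).1 ∂μ ≤ pMoment p y₀ ν.1 :=
    calc ∫⁻ x, pMoment p y₀ (κ' x).1 ∂μ
        ≤ ∫⁻ x, liminf (fun k => pMoment p y₀ (κ k x).1) atTop ∂μ := lintegral_mono_ae hwle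
      _ ≤ liminf (fun k => ∫⁻ x, pMoment p y₀ (κ k x).1 ∂μ) atTop :=
        lintegral_liminf_le fun k => measurable_pMoment_comp (hκm k)
      _ ≤ liminf (fun k : ℕ => pMoment p y₀ ν.1 + ENNReal.ofReal (1 / ((k : ℝ) + 1))) atTop :=
        liminf_le_liminf (.of_forall fun k => (hκ k).2.2.1)
      _ = pMoment p y₀ ν.1 := herrM.liminf_eq
  have hbindP := isProbabilityMeasure_bind_of_measurable (μ := μ) hκ'v fun x => inferInstance
  have hw : Measurable fun y => ENNReal.ofReal (dist y y₀ ^ p) := by fun_prop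
  have hbindw : pMoment p y₀ (μ.bind fun x => (κ' x).1) = ∫⁻ x, pMoment p y₀ (κ' x).1 ∂μ :=
    Measure.lintegral_bind hκ'v.aemeasurable hw.aemeasurable
  have hbindM : HasMomentPY p (μ.bind fun x => (κ' x).1) := by
    refine hasMomentPY_of_lintegral_ne_top hp (y₀ := y₀) ?_
    change pMoment p y₀ _ ≠ ⊤
    rw [hbindw]
    exact ne_top_of_le_ne_top (pMoment_ne_top y₀ ν) hMle
  have hbind : (⟨μ.bind fun x => (κ' x).1, hbindP, hbindM⟩ : PpY p Y) = ν := by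
    rw [← T.decode_integralSeq ν, ← T.decode_integralSeq ⟨_, _⟩]
    congr 1
    ext i
    refine tendsto_nhds_unique ?_ (hν i)
    simp only [integralSeq]
    rw [integral_bind_of_integrable hκ'v
      (integrable_of_abs_le_one (T.continuous i).measurable (T.abs_le_one i))]
    refine tendsto_integral_of_dominated_convergence (fun _ => 1)
      (fun k => (measurable_integralSeq_apply T (hκm k) i).aestronglyMeasurable)
      (integrable_const _) (fun k => .of_forall fun x => abs_integral_le_one (T.abs_le_one i)) ?_
    filter_upwards [hlim'] with x hx using tendsto_pi_nhds.1 hx i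
  have hbind' : μ.bind (fun x => (κ' x).1) = ν.1 := congrArg Subtype.val hbind
  rw [hbind'] at hbindw
  obtain ⟨n, hn, hsub⟩ := exists_subseq_ae_tendsto_of_le_liminf
    (measurable_pMoment_comp hκ'm) (fun k => measurable_pMoment_comp (hκm k))
    (hbindw ▸ pMoment_ne_top y₀ ν) hwle (hbindw ▸ herrM) (fun k => (hκ k).2.2.1)
  refine ⟨κ', hκ'm, hbind', ?_⟩
  calc ∫⁻ x, c x (κ' x) ∂μ ≤ ∫⁻ x, liminf (fun k => c x (κ (n k) x)) atTop ∂μ := by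
        refine lintegral_mono_ae ?_
        filter_upwards [hsub, hlim'] with x h1 h2
        have h3 := T.tendsto_of_tendsto_integralSeq hp (h2.comp hn.tendsto_atTop) h1
        exact hc.le_liminf_of_tendsto ((tendsto_const_nhds (x := x)).prodMk_nhds h3)
    _ ≤ liminf (fun k => ∫⁻ x, c x (κ (n k) x) ∂μ) atTop :=
        lintegral_liminf_le fun k => hcκ (hκm _)
    _ ≤ liminf (fun k : ℕ => t₀ + ENNReal.ofReal (1 / ((n k : ℝ) + 1))) atTop :=
        liminf_le_liminf (.of_forall fun k => (hκ (n k)).2.2.2)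
    _ = t₀ := by
        have := (herr.comp hn.tendsto_atTop).const_add t₀
        rw [add_zero] at this
        exact this.liminf_eq

end Closed

section Separation

universe u v

variable {p : ℝ} {Y : Type u} [MetricSpace Y] [MeasurableSpace Y] [BorelSpace Y]
  {X : Type v} [MeasurableSpace X]

/-- If there is no almost admissible kernel, then admissible kernels can be separated by a
combination of finitely many test functions, the moment and the cost. -/
lemma TestSequence.exists_separation (T : TestSequence.{u, v} p Y) (y₀ : Y)
    (μ : Measure X) [IsProbabilityMeasure μ] (ν : PpY p Y) {c : X → PpY p Y → ℝ≥0∞}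
    (hcm : ∀ κ : X → PpY p Y, Measurable κ → Measurable fun x => c x (κ x))
    (hconv : ∀ x ρ₁ ρ₂ t (ht : t ≤ 1),
      c x (PpY.mix t ht ρ₁ ρ₂) ≤ t * c x ρ₁ + (1 - t) * c x ρ₂) {t₀ : ℝ} (ht₀ : 0 ≤ t₀) {n : ℕ}
    (hempty : T.almostAdmissible y₀ μ ν c (ENNReal.ofReal t₀) n = ∅) :
    ∃ (a : Fin n → ℝ) (b u : ℝ), 0 < b ∧
      ∑ i, a i * ∫ y, T.φ i y ∂ν.1 + b * (pMoment p y₀ ν.1).toReal + t₀ < u ∧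
      ∀ κ : X → PpY p Y, Measurable κ → ∫⁻ x, pMoment p y₀ (κ x).1 ∂μ ≠ ⊤ →
        ∫⁻ x, c x (κ x) ∂μ ≠ ⊤ →
        u ≤ ∑ i : Fin n, a i * ∫ x, integralSeq T.φ (κ x).1 i ∂μ +
          b * (∫⁻ x, pMoment p y₀ (κ x).1 ∂μ).toReal + (∫⁻ x, c x (κ x) ∂μ).toReal := by
  set M : ℝ := (pMoment p y₀ ν.1).toReal with hM
  have hM0 : 0 ≤ M := ENNReal.toReal_nonneg
  have hMν : pMoment p y₀ ν.1 = ENNReal.ofReal M :=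
    (ENNReal.ofReal_toReal (pMoment_ne_top y₀ ν)).symm
  set r : ℝ := 1 / ((n : ℝ) + 1) with hr
  have hr0 : 0 < r := by positivity
  let v₀ : Fin n → ℝ := fun i => ∫ y, T.φ i y ∂ν.1
  let U : Set ((Fin n → ℝ) × ℝ × ℝ) := Metric.ball v₀ r ×ˢ Iio (M + r) ×ˢ Iio (t₀ + r)
  let S : Set ((Fin n → ℝ) × ℝ × ℝ) := {q | 0 ≤ q.2.1 ∧ 0 ≤ q.2.2 ∧ ∃ κ : X → PpY p Y,
    Measurable κ ∧ (∀ i : Fin n, q.1 i = ∫ x, integralSeq T.φ (κ x).1 i ∂μ) ∧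
    ∫⁻ x, pMoment p y₀ (κ x).1 ∂μ ≤ ENNReal.ofReal q.2.1 ∧
    ∫⁻ x, c x (κ x) ∂μ ≤ ENNReal.ofReal q.2.2}
  have hUo : IsOpen U := Metric.isOpen_ball.prod (isOpen_Iio.prod isOpen_Iio)
  have hUc : Convex ℝ U := (convex_ball _ _).prod ((convex_Iio _).prod (convex_Iio _))
  have hSc : Convex ℝ S := by
    rintro q₁ ⟨hm₁, ht₁, κ₁, hκ₁, hv₁, hw₁, hc₁⟩ q₂ ⟨hm₂, ht₂, κ₂, hκ₂, hv₂, hw₂, hc₂⟩ a b ha hb hab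
    have ht : ENNReal.ofReal a ≤ 1 := ENNReal.ofReal_le_one.2 (by linarith)
    have hb' : 1 - ENNReal.ofReal a = ENNReal.ofReal b := by
      rw [← ENNReal.ofReal_one, ← ENNReal.ofReal_sub _ ha, ← hab, add_sub_cancel_left]
    have key {m₁ m₂ : ℝ} {l₁ l₂ : ℝ≥0∞} (h₁ : 0 ≤ m₁) (h₂ : 0 ≤ m₂) (h₁' : l₁ ≤ ENNReal.ofReal m₁)
        (h₂' : l₂ ≤ ENNReal.ofReal m₂) : ENNReal.ofReal a * l₁ + (1 - ENNReal.ofReal a) * l₂ ≤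
          ENNReal.ofReal (a * m₁ + b * m₂) := by
      rw [hb', ENNReal.ofReal_add (by positivity) (by positivity), ENNReal.ofReal_mul ha,
        ENNReal.ofReal_mul hb]
      gcongr
    refine ⟨?_, ?_, _, PpY.measurable_mix ht hκ₁ hκ₂, fun i => ?_, ?_, ?_⟩
    · simp only [Prod.snd_add, Prod.fst_add, Prod.smul_snd, Prod.smul_fst, smul_eq_mul]
      positivity
    · simp only [Prod.snd_add, Prod.smul_snd, smul_eq_mul]
      positivity
    · rw [integral_integralSeq_mix T μ ht hκ₁ hκ₂, ← hv₁, ← hv₂, ENNReal.toReal_ofReal ha,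
        ← hab, add_sub_cancel_left]
      rfl
    · exact (lintegral_le_of_le_mix ht (measurable_pMoment_comp hκ₁)
        fun x => (PpY.lintegral_mix ht _ _ _).le).trans (key hm₁ hm₂ hw₁ hw₂)
    · exact (lintegral_le_of_le_mix ht (hcm _ hκ₁) fun x => hconv _ _ _ _ _).trans
        (key ht₁ ht₂ hc₁ hc₂)
  have hdisj : Disjoint U S := by
    refine Set.disjoint_left.2 ?_
    rintro q ⟨hq₁, hq₂, hq₃⟩ ⟨hm, ht, κ, hκ, hv, hw, hc⟩
    refine (hempty ▸ notMem_empty κ : κ ∉ T.almostAdmissible y₀ μ ν c (ENNReal.ofReal t₀) n)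
      ⟨hκ, fun i hi => ?_, hw.trans ?_, hc.trans ?_⟩
    · have := (dist_le_pi_dist q.1 v₀ ⟨i, hi⟩).trans (Metric.mem_ball.1 hq₁).le
      rw [hv, Real.dist_eq] at this
      exact this
    · rw [hMν, ← ENNReal.ofReal_add hM0 hr0.le]
      exact ENNReal.ofReal_le_ofReal (le_of_lt hq₂)
    · rw [← ENNReal.ofReal_add ht₀ hr0.le]
      exact ENNReal.ofReal_le_ofReal (le_of_lt hq₃)
  obtain ⟨f, u, hfU, hfS⟩ := geometric_hahn_banach_open hUc hUo hSc hdisj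
  let a : Fin n → ℝ := fun i => f (Pi.single i 1, 0, 0)
  set b := f (0, 1, 0) with hb
  set l := f (0, 0, 1) with hl
  have hf (w : Fin n → ℝ) (m t : ℝ) : f (w, m, t) = ∑ i, a i * w i + b * m + l * t := by
    have h1 : ((w, m, t) : (Fin n → ℝ) × ℝ × ℝ) =
        (w, 0, 0) + (m • (0, 1, 0) + t • (0, 0, 1)) := by simp
    have h2 : f (w, 0, 0) = ∑ i, a i * w i := by
      have := LinearMap.pi_apply_eq_sum_univ
        ((f : (Fin n → ℝ) × ℝ × ℝ →ₗ[ℝ] ℝ) ∘ₗ LinearMap.inl ℝ (Fin n → ℝ) (ℝ × ℝ)) w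
      refine this.trans (Finset.sum_congr rfl fun i _ => ?_)
      rw [smul_eq_mul, mul_comm]
      have h3 : (fun j => if i = j then (1 : ℝ) else 0) = Pi.single i 1 := by
        ext j
        simp [Pi.single_apply, eq_comm]
      rw [h3]
      rfl
    rw [h1, map_add, map_add, map_smul, map_smul, h2, ← hb, ← hl, smul_eq_mul, smul_eq_mul]
    ring
  have hmem {m t : ℝ} (hm : m < M + r) (ht : t < t₀ + r) :
      ∑ i, a i * v₀ i + b * m + l * t < u := by
    rw [← hf]
    exact hfU _ ⟨Metric.mem_ball_self hr0, hm, ht⟩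
  have hnonneg {d e : ℝ} (h : ∀ s : ℝ, 0 ≤ s → e - d * s < u) : 0 ≤ d := by
    by_contra! hd
    have h1 := h (|u - e| / -d) (div_nonneg (abs_nonneg _) (by linarith))
    have h2 : d * (|u - e| / -d) = -|u - e| := by
      have := hd.ne
      field_simp
    rw [h2] at h1
    linarith [le_abs_self (u - e)]
  have hb0 : 0 ≤ b := hnonneg (e := ∑ i, a i * v₀ i + b * M + l * t₀) fun s hs => by
    have := hmem (m := M - s) (t := t₀) (by linarith) (by linarith)
    linarith
  have hl0 : 0 ≤ l := hnonneg (e := ∑ i, a i * v₀ i + b * M + l * t₀) fun s hs => by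
    have := hmem (m := M) (t := t₀ - s) (by linarith) (by linarith)
    linarith
  have hP := hmem (m := M) (t := t₀) (by linarith) (by linarith)
  set η : ℝ := (u - (∑ i, a i * v₀ i + b * M + l * t₀)) / (M + t₀ + 1) with hη
  have hη0 : 0 < η := div_pos (by linarith) (by linarith)
  have hη1 : η * (M + t₀ + 1) = u - (∑ i, a i * v₀ i + b * M + l * t₀) :=
    div_mul_cancel₀ _ (by linarith)
  have hlη : 0 < l + η := by linarith
  have hdiv (w : Fin n → ℝ) (m t : ℝ) : ∑ i, a i / (l + η) * w i + (b + η) / (l + η) * m + t =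
      (∑ i, a i * w i + (b + η) * m + (l + η) * t) / (l + η) := by
    rw [add_div _ ((l + η) * t), add_div (∑ i, a i * w i), Finset.sum_div,
      mul_div_cancel_left₀ _ hlη.ne', mul_div_right_comm]
    simp only [mul_div_right_comm]
  refine ⟨fun i => a i / (l + η), (b + η) / (l + η), u / (l + η), by positivity, ?_,
    fun κ hκ h1 h2 => ?_⟩
  · rw [hdiv v₀]
    gcongr
    linarith
  · rw [hdiv fun i => ∫ x, integralSeq T.φ (κ x).1 i ∂μ]
    gcongr
    have h3 := hfS (fun i => ∫ x, integralSeq T.φ (κ x).1 i ∂μ,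
      (∫⁻ x, pMoment p y₀ (κ x).1 ∂μ).toReal, (∫⁻ x, c x (κ x) ∂μ).toReal)
      ⟨ENNReal.toReal_nonneg, ENNReal.toReal_nonneg, κ, hκ, fun _ => rfl,
        (ENNReal.ofReal_toReal h1).ge, (ENNReal.ofReal_toReal h2).ge⟩
    rw [hf] at h3
    have h4 := mul_nonneg hη0.le (ENNReal.toReal_nonneg (a := ∫⁻ x, pMoment p y₀ (κ x).1 ∂μ))
    have h5 := mul_nonneg hη0.le (ENNReal.toReal_nonneg (a := ∫⁻ x, c x (κ x) ∂μ))
    linarith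

end Separation

section Potential

universe u v

variable {p : ℝ} {Y : Type u} [MetricSpace Y] [MeasurableSpace Y] [BorelSpace Y]
  {X : Type v} [MeasurableSpace X]

lemma TestSequence.exists_potential_of_almostAdmissible_eq_empty (T : TestSequence.{u, v} p Y)
    (hp : 0 ≤ p) (y₀ : Y) (μ : Measure X) [IsProbabilityMeasure μ] (ν : PpY p Y)
    {c : X → PpY p Y → ℝ≥0∞}
    (hcm : ∀ κ : X → PpY p Y, Measurable κ → Measurable fun x => c x (κ x))
    (hconv : ∀ x ρ₁ ρ₂ t (ht : t ≤ 1),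
      c x (PpY.mix t ht ρ₁ ρ₂) ≤ t * c x ρ₁ + (1 - t) * c x ρ₂) {t₀ : ℝ} (ht₀ : 0 ≤ t₀) {n : ℕ}
    (hempty : T.almostAdmissible y₀ μ ν c (ENNReal.ofReal t₀) n = ∅) :
    ∃ ψ : Y → ℝ, Continuous ψ ∧ (∃ b > 0, ∀ y, b * dist y y₀ ^ p ≤ ψ y) ∧
      (∃ K > 0, ∀ y, ψ y ≤ K * (1 + dist y y₀ ^ p)) ∧
      ∃ β : ℝ≥0∞, ENNReal.ofReal (∫ y, ψ y ∂ν.1) + ENNReal.ofReal t₀ < β ∧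
        ∀ κ : X → PpY p Y, Measurable κ →
          β ≤ ∫⁻ x, (∫⁻ y, ENNReal.ofReal (ψ y) ∂(κ x).1 + c x (κ x)) ∂μ := by
  obtain ⟨a, b, u, hb, hu, hκu⟩ := T.exists_separation y₀ μ ν hcm hconv ht₀ hempty
  let A : ℝ := ∑ i, |a i|
  let ψ : Y → ℝ := fun y => ∑ i : Fin n, a i * T.φ i y + b * dist y y₀ ^ p + A
  have hA (y) : |∑ i : Fin n, a i * T.φ i y| ≤ A :=
    (Finset.abs_sum_le_sum_abs _ _).trans (Finset.sum_le_sum fun i _ => by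
      rw [abs_mul]
      exact mul_le_of_le_one_right (abs_nonneg _) (T.abs_le_one i y))
  have hA0 : 0 ≤ A := Finset.sum_nonneg fun i _ => abs_nonneg _
  have hd (y) : 0 ≤ dist y y₀ ^ p := by positivity
  have hψlow (y) : b * dist y y₀ ^ p ≤ ψ y := by
    have := (abs_le.1 (hA y)).1
    simp only [ψ]
    linarith
  have hψ0 (y) : 0 ≤ ψ y := (mul_nonneg hb.le (hd y)).trans (hψlow y)
  have hψup (y) : ψ y ≤ (2 * A + b) * (1 + dist y y₀ ^ p) := by
    have := (abs_le.1 (hA y)).2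
    have := mul_nonneg hA0 (hd y)
    simp only [ψ]
    linarith
  have hψc : Continuous ψ := by
    have := continuous_dist_rpow hp y₀
    have := T.continuous
    fun_prop
  have hφi (ρ : PpY p Y) (i) : Integrable (T.φ i) ρ.1 :=
    integrable_of_abs_le_one (T.continuous i).measurable (T.abs_le_one i)
  have hψi (ρ : PpY p Y) : Integrable ψ ρ.1 :=
    integrable_of_growth hψc.measurable (fun y => (abs_of_nonneg (hψ0 y)).trans_le (hψup y)) ρ
  have hψint (ρ : PpY p Y) : ∫ y, ψ y ∂ρ.1 =
      ∑ i : Fin n, a i * ∫ y, T.φ i y ∂ρ.1 + b * (pMoment p y₀ ρ.1).toReal + A := by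
    have h1 : Integrable (fun y => ∑ i : Fin n, a i * T.φ i y) ρ.1 :=
      integrable_finsetSum _ fun i _ => (hφi ρ i).const_mul _
    have h2 := (integrable_dist_rpow y₀ ρ).const_mul b
    have h12 : Integrable (fun y => ∑ i : Fin n, a i * T.φ i y + b * dist y y₀ ^ p) ρ.1 := h1.add h2
    simp only [ψ]
    rw [integral_add h12 (integrable_const A), integral_add h1 h2,
      integral_finsetSum _ fun (i : Fin n) _ => (hφi ρ i).const_mul (a i), integral_const_mul,
      ← ofReal_integral_dist_rpow, ENNReal.toReal_ofReal (integral_nonneg hd)]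
    simp [integral_const_mul]
  refine ⟨ψ, hψc, ⟨b, hb, hψlow⟩, ⟨2 * A + b, by linarith, hψup⟩, ENNReal.ofReal (u + A), ?_,
    fun κ hκ => ?_⟩
  · have h0 : 0 ≤ ∫ y, ψ y ∂ν.1 := integral_nonneg hψ0
    have h1 := hψint ν
    rw [← ENNReal.ofReal_add h0 ht₀]
    refine (ENNReal.ofReal_lt_ofReal_iff ?_).2 ?_ <;> linarith
  · have hψm : Measurable fun x => ∫⁻ y, ENNReal.ofReal (ψ y) ∂(κ x).1 :=
      (Measure.measurable_lintegral hψc.measurable.ennreal_ofReal).comp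
        (measurable_subtype_coe.comp hκ)
    rw [lintegral_add_left hψm]
    have hmom : ENNReal.ofReal b * ∫⁻ x, pMoment p y₀ (κ x).1 ∂μ ≤
        ∫⁻ x, ∫⁻ y, ENNReal.ofReal (ψ y) ∂(κ x).1 ∂μ := by
      rw [← lintegral_const_mul _ (measurable_pMoment_comp hκ)]
      refine lintegral_mono fun x => ?_
      rw [pMoment, ← lintegral_const_mul' _ _ ENNReal.ofReal_ne_top]
      refine lintegral_mono fun y => ?_
      rw [← ENNReal.ofReal_mul hb.le]
      exact ENNReal.ofReal_le_ofReal (hψlow y)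
    by_cases h1 : ∫⁻ x, pMoment p y₀ (κ x).1 ∂μ = ⊤
    · rw [h1, ENNReal.mul_top (ENNReal.ofReal_pos.2 hb).ne', top_le_iff] at hmom
      rw [hmom, top_add]
      exact le_top
    by_cases h2 : ∫⁻ x, c x (κ x) ∂μ = ⊤
    · rw [h2, add_top]
      exact le_top
    have h3 := hκu κ hκ h1 h2
    have hpm := measurable_pMoment_comp (y₀ := y₀) hκ
    have hi1 : Integrable (fun x => ∑ i : Fin n, a i * integralSeq T.φ (κ x).1 i) μ :=
      integrable_finsetSum _ fun i _ => (integrable_integralSeq T μ hκ i).const_mul _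
    have hi2 : Integrable (fun x => b * (pMoment p y₀ (κ x).1).toReal) μ :=
      (integrable_toReal_of_lintegral_ne_top hpm.aemeasurable h1).const_mul b
    have hi12 : Integrable (fun x => ∑ i : Fin n, a i * integralSeq T.φ (κ x).1 i +
        b * (pMoment p y₀ (κ x).1).toReal) μ := hi1.add hi2
    have hi : Integrable (fun x => ∑ i : Fin n, a i * integralSeq T.φ (κ x).1 i +
        b * (pMoment p y₀ (κ x).1).toReal + A) μ := hi12.add (integrable_const A)
    have hψx (x) : ∫⁻ y, ENNReal.ofReal (ψ y) ∂(κ x).1 = ENNReal.ofReal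
        (∑ i : Fin n, a i * integralSeq T.φ (κ x).1 i + b * (pMoment p y₀ (κ x).1).toReal + A) := by
      rw [← ofReal_integral_eq_lintegral_ofReal (hψi _) (.of_forall hψ0), hψint]
      rfl
    have hψx0 (x) : 0 ≤ ∑ i : Fin n, a i * integralSeq T.φ (κ x).1 i +
        b * (pMoment p y₀ (κ x).1).toReal + A := by
      have := hψint (κ x)
      exact this ▸ integral_nonneg hψ0
    rw [lintegral_congr hψx, ← ofReal_integral_eq_lintegral_ofReal hi (.of_forall hψx0),
      ← ENNReal.ofReal_toReal h2,
      ← ENNReal.ofReal_add (integral_nonneg hψx0) ENNReal.toReal_nonneg,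
      integral_add hi12 (integrable_const A), integral_add hi1 hi2,
      integral_finsetSum _ fun (i : Fin n) _ => (integrable_integralSeq T μ hκ i).const_mul (a i),
      integral_const_mul, integral_toReal hpm.aemeasurable (.of_forall fun x =>
        (pMoment_ne_top y₀ (κ x)).lt_top)]
    refine ENNReal.ofReal_le_ofReal ?_
    simp only [integral_const_mul, integral_const, probReal_univ, one_smul]
    linarith

/-- The hard inequality of the duality for potentials which are continuous. -/
lemma TestSequence.exists_potential (T : TestSequence.{u, v} p Y) (hp : 0 ≤ p) (y₀ : Y)
    [TopologicalSpace X] [PolishSpace X] [BorelSpace X]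
    (μ : Measure X) [IsProbabilityMeasure μ] (ν : PpY p Y) {c : X → PpY p Y → ℝ≥0∞}
    (hc : LowerSemicontinuous fun q : X × PpY p Y => c q.1 q.2)
    (hconv : ∀ x ρ₁ ρ₂ t (ht : t ≤ 1),
      c x (PpY.mix t ht ρ₁ ρ₂) ≤ t * c x ρ₁ + (1 - t) * c x ρ₂) {t₀ : ℝ≥0∞} (ht₀ : t₀ ≠ ⊤)
    (hlt : ∀ κ : X → PpY p Y, Measurable κ → μ.bind (fun x => (κ x).1) = ν.1 →
      t₀ < ∫⁻ x, c x (κ x) ∂μ) :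
    ∃ ψ : Y → ℝ, Continuous ψ ∧ (∃ b > 0, ∀ y, b * dist y y₀ ^ p ≤ ψ y) ∧
      (∃ K > 0, ∀ y, ψ y ≤ K * (1 + dist y y₀ ^ p)) ∧
      ENNReal.ofReal (∫ y, ψ y ∂ν.1) + t₀ <
        ∫⁻ x, ⨅ ρ : PpY p Y, ∫⁻ y, ENNReal.ofReal (ψ y) ∂ρ.1 + c x ρ ∂μ := by
  have hcm : Measurable fun q : X × PpY p Y => c q.1 q.2 :=
    T.measurable_of_lowerSemicontinuous hp y₀ hc
  obtain ⟨n, hn⟩ : ∃ n, T.almostAdmissible y₀ μ ν c t₀ n = ∅ := by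
    by_contra! h
    obtain ⟨κ, hκ, hb, hle⟩ := T.exists_admissible hp y₀ μ ν hc hconv h
    exact hle.not_gt (hlt κ hκ hb)
  rw [← ENNReal.ofReal_toReal ht₀] at hn ⊢
  obtain ⟨ψ, hψ, hlow, hup, β, hβ, hle⟩ := T.exists_potential_of_almostAdmissible_eq_empty hp y₀ μ ν
    (fun κ hκ => hcm.comp (measurable_id.prodMk hκ)) hconv ENNReal.toReal_nonneg hn
  refine ⟨ψ, hψ, hlow, hup, hβ.trans_le (ENNReal.le_of_forall_pos_le_add fun ε hε _ => ?_)⟩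
  have hΦ : Measurable fun q : X × PpY p Y =>
      ∫⁻ y, ENNReal.ofReal (ψ y) ∂q.2.1 + c q.1 q.2 :=
    ((Measure.measurable_lintegral hψ.measurable.ennreal_ofReal).comp
      (measurable_subtype_coe.comp measurable_snd)).add hcm
  obtain ⟨κ, hκ, hκε⟩ := exists_measurable_almost_minimizer μ T.measurable_decode
    (fun ρ => ⟨_, T.decode_integralSeq ρ⟩) hΦ (ENNReal.coe_ne_zero.2 hε.ne')
  calc β ≤ _ := hle κ hκ
    _ ≤ ∫⁻ x, (⨅ ρ : PpY p Y, ∫⁻ y, ENNReal.ofReal (ψ y) ∂ρ.1 + c x ρ) + ε ∂μ :=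
      lintegral_mono_ae hκε
    _ = _ := by rw [lintegral_add_right _ measurable_const]; simp

end Potential

lemma integrable_integral_of_bind {X Y : Type*} [MeasurableSpace X] [MeasurableSpace Y]
    {μ : Measure X} {κ : X → Measure Y} (hκ : Measurable κ)
    {f : Y → ℝ} (hf : Integrable f (μ.bind κ)) : Integrable (fun x => ∫ y, f y ∂(κ x)) μ := by
  have h := Measure.comp_eq_comp_const_apply (μ := μ) (κ := ⟨κ, hκ⟩)
  change μ.bind κ = _ at h
  rw [h] at hf
  exact hf.integral_comp

section Hull

universe u

variable {p : ℝ} {Y : Type u} [MetricSpace Y] [MeasurableSpace Y]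

lemma LSCp.measurable [BorelSpace Y] {f : Y → ℝ} (hf : LSCp p f) : Measurable f :=
  hf.1.measurable

lemma LSCp.integrable [BorelSpace Y] {f : Y → ℝ} (hf : LSCp p f) (ρ : PpY p Y) :
    Integrable f ρ.1 := by
  obtain ⟨K, y₁, h⟩ := hf.2
  exact integrable_of_growth hf.measurable h ρ

lemma GrowthPY.continuous_integral {f : Y → ℝ} (hf : GrowthPY p f) :
    Continuous fun ρ : PpY p Y => ∫ y, f y ∂ρ.1 :=
  continuous_iInf_dom (i := (⟨f, hf⟩ : {f : Y → ℝ // GrowthPY p f})) continuous_induced_dom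

namespace StableCone

variable (E : StableCone p Y)

/-- The largest element of the stable cone below a function. -/
noncomputable def hull (ψ : Y → ℝ) (y : Y) : ℝ :=
  ⨆ φ : {φ : Y → ℝ | φ ∈ E.carrier ∧ ∀ z, φ z ≤ ψ z}, φ.1 y

section

variable {ψ : Y → ℝ}

lemma le_hull {φ : Y → ℝ} (hφ : φ ∈ E.carrier) (hle : ∀ z, φ z ≤ ψ z) (y : Y) :
    φ y ≤ E.hull ψ y := by
  refine le_ciSup (f := fun φ : {φ : Y → ℝ | φ ∈ E.carrier ∧ ∀ z, φ z ≤ ψ z} => φ.1 y) ⟨ψ y, ?_⟩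
    ⟨φ, hφ, hle⟩
  rintro _ ⟨φ, rfl⟩
  exact φ.2.2 y

lemma hull_nonneg (hψ : ∀ y, 0 ≤ ψ y) (y : Y) : 0 ≤ E.hull ψ y :=
  E.le_hull (E.const_mem 0) hψ y

lemma hull_le (hψ : ∀ y, 0 ≤ ψ y) (y : Y) : E.hull ψ y ≤ ψ y := by
  have : Nonempty {φ : Y → ℝ | φ ∈ E.carrier ∧ ∀ z, φ z ≤ ψ z} := ⟨⟨_, E.const_mem 0, hψ⟩⟩
  exact ciSup_le fun φ => φ.2.2 y

lemma hull_mem (hψ : ∀ y, 0 ≤ ψ y) {y₀ : Y} {K : ℝ} (hK : ∀ y, ψ y ≤ K * (1 + dist y y₀ ^ p)) :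
    E.hull ψ ∈ E.carrier := by
  refine E.sup_mem {φ : Y → ℝ | φ ∈ E.carrier ∧ ∀ z, φ z ≤ ψ z} (fun φ hφ => hφ.1)
    ⟨_, E.const_mem 0, hψ⟩ (fun y => ⟨ψ y, ?_⟩) ⟨?_, K, y₀, fun y => ?_⟩
  · rintro _ ⟨φ, hφ, rfl⟩
    exact hφ.2 y
  · refine lowerSemicontinuous_ciSup (fun y => ⟨ψ y, ?_⟩) fun φ => (E.subset_lscp _ φ.2.1).1
    rintro _ ⟨φ, rfl⟩
    exact φ.2.2 y
  · exact (abs_of_nonneg (E.hull_nonneg hψ y)).trans_le ((E.hull_le hψ y).trans (hK y))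

end

lemma eOrder_dirac_iff [BorelSpace Y] (y : Y) (ρ : PpY p Y) :
    EOrder E.carrier (Measure.dirac y) ρ.1 ↔
      ∀ g ∈ E.carrier, Continuous g → g y ≤ ∫ z, g z ∂ρ.1 := by
  refine ⟨fun h g hg _ => by simpa using h g hg, fun h f hf => ?_⟩
  rw [integral_dirac]
  obtain ⟨S, hS, hSne, hSc, hbdd, hfS⟩ := E.sup_continuous f hf
  have : Nonempty S := hSne.to_subtype
  rw [hfS y]
  refine ciSup_le fun g => (h g.1 (hS g.2) (hSc g.1 g.2)).trans ?_
  refine integral_mono ((E.subset_lscp _ (hS g.2)).integrable ρ)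
    ((E.subset_lscp _ hf).integrable ρ) fun z => ?_
  rw [hfS z]
  refine le_ciSup (f := fun g : S => g.1 z) ((hbdd z).mono ?_) g
  rintro _ ⟨g, rfl⟩
  exact ⟨g.1, g.2, rfl⟩

lemma isClosed_setOf_eOrder_dirac [BorelSpace Y] :
    IsClosed {q : Y × PpY p Y | EOrder E.carrier (Measure.dirac q.1) q.2.1} := by
  simp only [eOrder_dirac_iff, ofPred_forall]
  refine isClosed_iInter fun g => isClosed_iInter fun hg => isClosed_iInter fun hgc =>
    isClosed_le (hgc.comp continuous_fst) (GrowthPY.continuous_integral ⟨hgc, ?_⟩ |>.comp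
      continuous_snd)
  exact (E.subset_lscp _ hg).2

lemma exists_eOrder_dirac_integral_lt {ψ : Y → ℝ} (hψ : CbpY p ψ) {y : Y} {r : ℝ}
    (hr : E.hull ψ y < r) :
    ∃ ρ : PpY p Y, EOrder E.carrier (Measure.dirac y) ρ.1 ∧ ∫ z, ψ z ∂ρ.1 < r := by
  have h : (⨅ ρ : {ρ : PpY p Y // EOrder E.carrier (Measure.dirac y) ρ.1},
      ((∫ z, ψ z ∂ρ.1.1 : ℝ) : EReal)) < (r : EReal) := by
    rw [← E.hull_repr ψ hψ y]
    exact (iSup_le fun φ => EReal.coe_le_coe_iff.2 (E.le_hull φ.2.1 φ.2.2 y)).trans_lt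
      (EReal.coe_lt_coe_iff.2 hr)
  obtain ⟨ρ, hρ⟩ := iInf_lt_iff.1 h
  exact ⟨ρ.1, ρ.2, EReal.coe_lt_coe_iff.1 hρ⟩

/-- A measure dominating `ρ` which almost realizes the integral of the hull. -/
lemma exists_eOrder_lintegral_le [PolishSpace Y] [BorelSpace Y] (hp : 0 ≤ p) {ψ : Y → ℝ}
    (hψc : Continuous ψ) {y₀ : Y} {b : ℝ} (hb : 0 < b) (hlow : ∀ y, b * dist y y₀ ^ p ≤ ψ y)
    {K : ℝ} (hK : 0 < K) (hup : ∀ y, ψ y ≤ K * (1 + dist y y₀ ^ p)) (ρ : PpY p Y)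
    {ε : ℝ≥0∞} (hε : ε ≠ 0) (hε' : ε ≠ ⊤) :
    ∃ ρ' : PpY p Y, EOrder E.carrier ρ.1 ρ'.1 ∧
      ∫⁻ y, ENNReal.ofReal (ψ y) ∂ρ'.1 ≤ ∫⁻ y, ENNReal.ofReal (E.hull ψ y) ∂ρ.1 + ε := by
  have hψ0 (y) : 0 ≤ ψ y := (mul_nonneg hb.le (by positivity)).trans (hlow y)
  have hψi (ρ : PpY p Y) : Integrable ψ ρ.1 :=
    integrable_of_growth hψc.measurable (fun y => (abs_of_nonneg (hψ0 y)).trans_le (hup y)) ρ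
  have hψE : Measurable fun y => ENNReal.ofReal (ψ y) := hψc.measurable.ennreal_ofReal
  have : Nonempty Y := ⟨y₀⟩
  obtain ⟨T⟩ := exists_testSequence.{u, u} (Y := Y) hp
  let R : Set (Y × PpY p Y) := {q | EOrder E.carrier (Measure.dirac q.1) q.2.1}
  let Φ : Y × PpY p Y → ℝ≥0∞ := fun q =>
    ∫⁻ y, ENNReal.ofReal (ψ y) ∂q.2.1 + Rᶜ.indicator (fun _ => ⊤) q
  have hΦ : Measurable Φ :=
    ((Measure.measurable_lintegral hψE).comp (measurable_subtype_coe.comp measurable_snd)).add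
      (T.measurable_of_lowerSemicontinuous hp y₀
        (E.isClosed_setOf_eOrder_dirac.isOpen_compl.lowerSemicontinuous_indicator zero_le))
  have hinf (y) : ⨅ ρ, Φ (y, ρ) ≤ ENNReal.ofReal (E.hull ψ y) := by
    refine ENNReal.le_of_forall_pos_le_add fun δ hδ _ => ?_
    obtain ⟨ρ, hρ, hlt⟩ := E.exists_eOrder_dirac_integral_lt
      ⟨hψc, ⟨0, hψ0⟩, K, hK, y₀, hup⟩ (r := E.hull ψ y + δ)
      (lt_add_of_pos_right _ (NNReal.coe_pos.2 hδ))
    refine (iInf_le _ ρ).trans ?_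
    have hR : (y, ρ) ∉ Rᶜ := fun h => h hρ
    simp only [Φ]
    rw [indicator_of_notMem hR, add_zero,
      ← ofReal_integral_eq_lintegral_ofReal (hψi ρ) (.of_forall hψ0)]
    refine (ENNReal.ofReal_le_ofReal hlt.le).trans ENNReal.ofReal_add_le |>.trans ?_
    rw [ENNReal.ofReal_coe_nnreal]
  obtain ⟨κ, hκ, hκε⟩ := exists_measurable_almost_minimizer ρ.1 T.measurable_decode
    (fun ρ => ⟨_, T.decode_integralSeq ρ⟩) hΦ hε
  have hκ' : Measurable fun y => (κ y).1 := measurable_subtype_coe.comp hκ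
  have hκR : ∀ᵐ y ∂ρ.1, EOrder E.carrier (Measure.dirac y) (κ y).1 ∧
      ∫⁻ z, ENNReal.ofReal (ψ z) ∂(κ y).1 ≤ ENNReal.ofReal (E.hull ψ y) + ε := by
    filter_upwards [hκε] with y hy
    have hy' := hy.trans (add_le_add_left (hinf y) ε)
    refine ⟨by_contra fun h => ?_, (le_add_of_nonneg_right zero_le).trans hy'⟩
    have hR : (y, κ y) ∈ Rᶜ := h
    simp only [Φ] at hy'
    rw [indicator_of_mem hR, add_top, top_le_iff] at hy'
    exact ENNReal.add_ne_top.2 ⟨ENNReal.ofReal_ne_top, hε'⟩ hy'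
  have hle : ∫⁻ y, ENNReal.ofReal (ψ y) ∂(ρ.1.bind fun y => (κ y).1) ≤
      ∫⁻ y, ENNReal.ofReal (E.hull ψ y) ∂ρ.1 + ε :=
    calc _ = ∫⁻ y, ∫⁻ z, ENNReal.ofReal (ψ z) ∂(κ y).1 ∂ρ.1 :=
          Measure.lintegral_bind hκ'.aemeasurable hψE.aemeasurable
      _ ≤ ∫⁻ y, ENNReal.ofReal (E.hull ψ y) + ε ∂ρ.1 :=
          lintegral_mono_ae (hκR.mono fun y hy => hy.2)
      _ = _ := by rw [lintegral_add_right _ measurable_const]; simp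
  have hfin : ∫⁻ y, ENNReal.ofReal (E.hull ψ y) ∂ρ.1 + ε ≠ ⊤ := by
    refine ENNReal.add_ne_top.2 ⟨ne_top_of_le_ne_top (hψi ρ).lintegral_lt_top.ne
      (lintegral_mono fun y => ENNReal.ofReal_le_ofReal (E.hull_le hψ0 y)), hε'⟩
  have hP := isProbabilityMeasure_bind_of_measurable (μ := ρ.1) hκ' fun y => inferInstance
  have hM : HasMomentPY p (ρ.1.bind fun y => (κ y).1) := by
    refine hasMomentPY_of_lintegral_ne_top hp (y₀ := y₀) fun htop => ?_
    refine ne_top_of_le_ne_top hfin hle (top_le_iff.1 ?_)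
    calc ⊤ = ENNReal.ofReal b * ∫⁻ y, ENNReal.ofReal (dist y y₀ ^ p)
            ∂(ρ.1.bind fun y => (κ y).1) := by
          rw [htop, ENNReal.mul_top (ENNReal.ofReal_pos.2 hb).ne']
      _ = ∫⁻ y, ENNReal.ofReal (b * dist y y₀ ^ p) ∂(ρ.1.bind fun y => (κ y).1) := by
          rw [← lintegral_const_mul' _ _ ENNReal.ofReal_ne_top]
          simp only [ENNReal.ofReal_mul hb.le]
      _ ≤ _ := lintegral_mono fun y => ENNReal.ofReal_le_ofReal (hlow y)
  refine ⟨⟨_, hP, hM⟩, fun f hf => ?_, hle⟩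
  have hfL := E.subset_lscp f hf
  have hfi : Integrable f (ρ.1.bind fun y => (κ y).1) := hfL.integrable ⟨_, hP, hM⟩
  change _ ≤ ∫ y, f y ∂(ρ.1.bind fun y => (κ y).1)
  rw [integral_bind_of_integrable hκ' hfi]
  refine integral_mono_ae (hfL.integrable ρ) (integrable_integral_of_bind hκ' hfi) ?_
  filter_upwards [hκR] with y hy
  simpa using hy.1 f hf

end StableCone

end Hull

section ExtendedIntegral

variable {X : Type*} [MeasurableSpace X]

lemma erealToENN_eq_toENNReal (x : EReal) : erealToENN x = x.toENNReal := by
  unfold erealToENN EReal.toENNReal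
  congr

lemma eInt_mono {μ : Measure X} {f g : X → EReal} (h : ∀ᵐ x ∂μ, f x ≤ g x) :
    eInt μ f ≤ eInt μ g := by
  simp only [eInt, erealToENN_eq_toENNReal]
  refine EReal.sub_le_sub (EReal.coe_ennreal_le_coe_ennreal_iff.2 (lintegral_mono_ae ?_))
    (EReal.coe_ennreal_le_coe_ennreal_iff.2 (lintegral_mono_ae ?_))
  · exact h.mono fun x hx => EReal.toENNReal_le_toENNReal hx
  · exact h.mono fun x hx => EReal.toENNReal_le_toENNReal (EReal.neg_le_neg_iff.2 hx)

lemma eInt_coe {μ : Measure X} {f : X → ℝ} (hf : Integrable f μ) :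
    eInt μ (fun x => (f x : EReal)) = ((∫ x, f x ∂μ : ℝ) : EReal) := by
  have hneg : ∫⁻ x, ENNReal.ofReal (-f x) ∂μ ≠ ⊤ := hf.neg.lintegral_lt_top.ne
  simp only [eInt, erealToENN_eq_toENNReal, EReal.real_coe_toENNReal, ← EReal.coe_neg]
  rw [integral_eq_lintegral_pos_part_sub_lintegral_neg_part hf, EReal.coe_sub,
    EReal.coe_ennreal_toReal hf.lintegral_lt_top.ne, EReal.coe_ennreal_toReal hneg]

lemma le_eInt_of_coe_le {μ : Measure X} {f : X → ℝ≥0∞} {g : X → EReal}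
    (h : ∀ x, (f x : EReal) ≤ g x) : ((∫⁻ x, f x ∂μ : ℝ≥0∞) : EReal) ≤ eInt μ g := by
  refine le_trans (le_of_eq ?_) (eInt_mono (.of_forall h))
  simp only [eInt, erealToENN_eq_toENNReal, EReal.toENNReal_coe]
  have h0 (x) : (-(f x : EReal)).toENNReal = 0 :=
    EReal.toENNReal_of_nonpos (EReal.neg_le_zero.2 (EReal.coe_ennreal_nonneg _))
  simp only [h0, lintegral_zero, EReal.coe_ennreal_zero, sub_zero]

end ExtendedIntegral

section Coupling

variable {p : ℝ} {Y : Type*} [MetricSpace Y] [PolishSpace Y] [MeasurableSpace Y] [BorelSpace Y]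
  [Nonempty Y] {X : Type*} [MeasurableSpace X]

lemma bind_disint {μ : Measure X} {ν : Measure Y} {π : Measure (X × Y)} (hπ : IsCoupling π μ ν) :
    μ.bind (disint π) = ν := by
  obtain ⟨h, rfl, rfl⟩ := hπ
  rw [disint, dif_pos (inferInstance : IsFiniteMeasure π)]
  change π.fst.bind π.condKernel = π.snd
  rw [← Measure.snd_compProd, Measure.disintegrate]

lemma isProbabilityMeasure_disint {π : Measure (X × Y)} [IsFiniteMeasure π] (x : X) :
    IsProbabilityMeasure (disint π x) := by
  rw [disint, dif_pos (inferInstance : IsFiniteMeasure π)]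
  infer_instance

/-- The disintegration of a coupling with second marginal in `P_p(Y)` takes values in `P_p(Y)`. -/
lemma IsCoupling.exists_kernel (hp : 0 ≤ p) {μ : Measure X} {ν : PpY p Y} {π : Measure (X × Y)}
    (hπ : IsCoupling π μ ν.1) :
    ∃ κ : X → PpY p Y, Measurable κ ∧ μ.bind (fun x => (κ x).1) = ν.1 ∧
      ∀ᵐ x ∂μ, (κ x).1 = disint π x := by
  have := hπ.1
  have hbind := bind_disint hπ
  let y₀ : Y := Classical.arbitrary Y
  have hw : Measurable fun y => ENNReal.ofReal (dist y y₀ ^ p) := by fun_prop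
  have hKm : Measurable fun x => pMoment p y₀ (disint π x) :=
    (measurable_pMoment y₀).comp (disint π).measurable
  have hlint : ∫⁻ x, pMoment p y₀ (disint π x) ∂μ = pMoment p y₀ ν.1 := by
    conv_rhs => rw [← hbind]
    exact (Measure.lintegral_bind (disint π).measurable.aemeasurable hw.aemeasurable).symm
  have hae : ∀ᵐ x ∂μ, pMoment p y₀ (disint π x) < ⊤ :=
    ae_lt_top hKm (hlint ▸ pMoment_ne_top y₀ ν)
  have hmeas : MeasurableSet {x | pMoment p y₀ (disint π x) < ⊤} := hKm measurableSet_Iio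
  classical
  let k : X → Measure Y := fun x =>
    if pMoment p y₀ (disint π x) < ⊤ then disint π x else Measure.dirac y₀
  have hk (x) : IsProbabilityMeasure (k x) ∧ HasMomentPY p (k x) := by
    have := isProbabilityMeasure_disint (π := π) x
    by_cases h : pMoment p y₀ (disint π x) < ⊤
    · simp only [k, if_pos h]
      exact ⟨inferInstance, hasMomentPY_of_lintegral_ne_top hp h.ne⟩
    · simp only [k, if_neg h]
      exact ⟨inferInstance, hasMomentPY_dirac y₀⟩
  have hkae : ∀ᵐ x ∂μ, k x = disint π x := hae.mono fun x hx => if_pos hx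
  refine ⟨fun x => ⟨k x, hk x⟩,
    (Measurable.ite hmeas (disint π).measurable measurable_const).subtype_mk, ?_, hkae⟩
  rw [← hbind]
  exact Measure.bind_congr_right hkae

lemma primalY_le_lintegral {μ : Measure X} [IsProbabilityMeasure μ] {ν : Measure Y}
    {C : X → Measure Y → ℝ≥0∞} {κ : X → PpY p Y} (hκ : Measurable κ)
    (hbind : μ.bind (fun x => (κ x).1) = ν) : primalY μ ν C ≤ ∫⁻ x, C x (κ x).1 ∂μ := by
  let K : ProbabilityTheory.Kernel X Y := ⟨fun x => (κ x).1, measurable_subtype_coe.comp hκ⟩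
  have hK : ProbabilityTheory.IsMarkovKernel K := ⟨fun x => (κ x).2.1⟩
  have hcoup : IsCoupling (μ.compProd K) μ ν :=
    ⟨inferInstance, Measure.fst_compProd μ K, (Measure.snd_compProd μ K).trans hbind⟩
  refine (iInf_le _ ⟨_, hcoup⟩).trans (le_of_eq (lintegral_congr_ae ?_))
  have h := ProbabilityTheory.eq_condKernel_of_measure_eq_compProd (ρ := μ.compProd K) K
    (by rw [Measure.fst_compProd])
  rw [Measure.fst_compProd] at h
  filter_upwards [h] with x hx
  rw [disint, dif_pos (inferInstance : IsFiniteMeasure (μ.compProd K)), ← hx]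
  rfl

lemma primalY_dirac [MeasurableSingletonClass X] (x : X) (ν : Measure Y) [IsProbabilityMeasure ν]
    (C : X → Measure Y → ℝ≥0∞) : primalY (Measure.dirac x) ν C = C x ν := by
  have h : ∀ π : {π : Measure (X × Y) // IsCoupling π (Measure.dirac x) ν},
      ∫⁻ x', C x' (disint π.1 x') ∂(Measure.dirac x) = C x ν := by
    rintro ⟨π, hπ⟩
    have := bind_disint hπ
    rw [Measure.dirac_bind (disint π).measurable] at this
    rw [lintegral_dirac, this]
  have : Nonempty {π : Measure (X × Y) // IsCoupling π (Measure.dirac x) ν} :=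
    ⟨⟨(Measure.dirac x).prod ν, inferInstance, by simp, by simp⟩⟩
  rw [primalY, iInf_congr h, iInf_const]

end Coupling

section Conjugate

variable {p : ℝ} {Y : Type*} [MetricSpace Y] [MeasurableSpace Y] {X : Type*}
  {C : X → Measure Y → ℝ≥0∞}

lemma eInt_conjY_sub_le [MeasurableSpace X] {μ : Measure X} [IsProbabilityMeasure μ] {ν : PpY p Y}
    {κ : X → PpY p Y} (hκ : Measurable κ)
    (hbind : μ.bind (fun x => (κ x).1) = ν.1) (hC : Measurable fun x => C x (κ x).1)
    {ψ : Y → ℝ} (hψ : Integrable ψ ν.1) :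
    eInt μ (conjY p C ψ) - ((∫ y, ψ y ∂ν.1 : ℝ) : EReal) ≤
      ((∫⁻ x, C x (κ x).1 ∂μ : ℝ≥0∞) : EReal) := by
  by_cases htop : ∫⁻ x, C x (κ x).1 ∂μ = ⊤
  · rw [htop]
    exact le_top
  have hκ' : Measurable fun x => (κ x).1 := measurable_subtype_coe.comp hκ
  rw [← hbind] at hψ ⊢
  have hi1 := integrable_integral_of_bind hκ' hψ
  have hi2 : Integrable (fun x => (C x (κ x).1).toReal) μ :=
    integrable_toReal_of_lintegral_ne_top hC.aemeasurable htop
  have hfin := ae_lt_top hC htop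
  refine EReal.sub_le_of_le_add ?_
  calc eInt μ (conjY p C ψ)
      ≤ eInt μ fun x => ((∫ y, ψ y ∂(κ x).1 + (C x (κ x).1).toReal : ℝ) : EReal) := by
        refine eInt_mono ?_
        filter_upwards [hfin] with x hx
        rw [EReal.coe_add, EReal.coe_ennreal_toReal hx.ne]
        exact iInf_le _ (κ x)
    _ = ((∫ x, (∫ y, ψ y ∂(κ x).1 + (C x (κ x).1).toReal) ∂μ : ℝ) : EReal) :=
        eInt_coe (hi1.add hi2)
    _ = _ := by
        rw [integral_add hi1 hi2, integral_toReal hC.aemeasurable hfin,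
          integral_bind_of_integrable hκ' hψ, EReal.coe_add, EReal.coe_ennreal_toReal htop,
          add_comm]

lemma coe_iInf_le_conjY [BorelSpace Y] [MeasurableSpace X] {ψ : Y → ℝ} (hψ : LSCp p ψ)
    (hψ0 : ∀ y, 0 ≤ ψ y) (x : X) :
    ((⨅ ρ : PpY p Y, ∫⁻ y, ENNReal.ofReal (ψ y) ∂ρ.1 + C x ρ.1 : ℝ≥0∞) : EReal) ≤
      conjY p C ψ x := by
  refine le_iInf fun ρ => ?_
  refine (EReal.coe_ennreal_le_coe_ennreal_iff.2 (iInf_le _ ρ)).trans (le_of_eq ?_)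
  rw [EReal.coe_ennreal_add, ← ofReal_integral_eq_lintegral_ofReal (hψ.integrable ρ)
    (.of_forall hψ0), EReal.coe_ennreal_ofReal, max_eq_left (integral_nonneg hψ0)]

lemma StableCone.iInf_le_iInf_hull [PolishSpace Y] [BorelSpace Y] (hp : 0 ≤ p)
    (E : StableCone p Y)
    (hdec : ∀ x : X, ∀ ρ₁ ρ₂ : PpY p Y, EOrder E.carrier ρ₁.1 ρ₂.1 → C x ρ₂.1 ≤ C x ρ₁.1)
    {ψ : Y → ℝ} (hψc : Continuous ψ) {y₀ : Y} {b K : ℝ} (hb : 0 < b)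
    (hlow : ∀ y, b * dist y y₀ ^ p ≤ ψ y) (hK : 0 < K)
    (hup : ∀ y, ψ y ≤ K * (1 + dist y y₀ ^ p)) (x : X) :
    ⨅ ρ : PpY p Y, ∫⁻ y, ENNReal.ofReal (ψ y) ∂ρ.1 + C x ρ.1 ≤
      ⨅ ρ : PpY p Y, ∫⁻ y, ENNReal.ofReal (E.hull ψ y) ∂ρ.1 + C x ρ.1 := by
  refine le_iInf fun ρ => ENNReal.le_of_forall_pos_le_add fun ε hε _ => ?_
  obtain ⟨ρ', hord, hle⟩ := E.exists_eOrder_lintegral_le hp hψc hb hlow hK hup ρ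
    (ENNReal.coe_ne_zero.2 hε.ne') ENNReal.coe_ne_top
  calc _ ≤ ∫⁻ y, ENNReal.ofReal (ψ y) ∂ρ'.1 + C x ρ'.1 := iInf_le _ ρ'
    _ ≤ ∫⁻ y, ENNReal.ofReal (E.hull ψ y) ∂ρ.1 + ε + C x ρ.1 := add_le_add hle (hdec x ρ ρ' hord)
    _ = _ := by ring

end Conjugate

section Duality

universe u v

variable {p : ℝ} {Y : Type u} [MetricSpace Y] [PolishSpace Y] [MeasurableSpace Y] [BorelSpace Y]
  [Nonempty Y] {X : Type v} [TopologicalSpace X] [PolishSpace X] [MeasurableSpace X] [BorelSpace X]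
  {C : X → Measure Y → ℝ≥0∞}

lemma measurable_cost (hp : 0 ≤ p) (hlsc : LowerSemicontinuous fun q : X × PpY p Y => C q.1 q.2.1)
    {κ : X → PpY p Y} (hκ : Measurable κ) : Measurable fun x => C x (κ x).1 := by
  obtain ⟨T⟩ := exists_testSequence.{u, v} (p := p) (Y := Y) hp
  exact (T.measurable_of_lowerSemicontinuous hp (Classical.arbitrary Y) hlsc).comp
    (measurable_id.prodMk hκ)

lemma dual_le_primalY (hp : 0 ≤ p)
    (hlsc : LowerSemicontinuous fun q : X × PpY p Y => C q.1 q.2.1) (E : StableCone p Y)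
    (μ : Measure X) [IsProbabilityMeasure μ] (ν : PpY p Y) {ψ : Y → ℝ} (hψ : ψ ∈ E.carrier) :
    eInt μ (conjY p C ψ) - ((∫ y, ψ y ∂ν.1 : ℝ) : EReal) ≤ (primalY μ ν.1 C : EReal) := by
  set A := eInt μ (conjY p C ψ) - ((∫ y, ψ y ∂ν.1 : ℝ) : EReal)
  have hA : A ≤ (A.toENNReal : EReal) := by
    rw [EReal.coe_toENNReal_eq_max]
    exact le_max_right _ _
  refine hA.trans (EReal.coe_ennreal_le_coe_ennreal_iff.2 (le_iInf fun π => ?_))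
  obtain ⟨κ, hκ, hbind, hae⟩ := π.2.exists_kernel hp
  have h : A ≤ ((∫⁻ x, C x (κ x).1 ∂μ : ℝ≥0∞) : EReal) :=
    eInt_conjY_sub_le hκ hbind (measurable_cost hp hlsc hκ) ((E.subset_lscp ψ hψ).integrable ν)
  refine (EReal.toENNReal_le_toENNReal h).trans (le_of_eq ?_)
  rw [EReal.toENNReal_coe]
  exact lintegral_congr_ae (hae.mono fun x hx => by simp only [hx])

lemma primalY_le_dual (hp : 0 ≤ p) (E : StableCone p Y)
    (hlsc : LowerSemicontinuous fun q : X × PpY p Y => C q.1 q.2.1)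
    (hconv : ∀ x : X, ∀ ρ₁ ρ₂ : PpY p Y, ∀ t : ℝ≥0∞, t ≤ 1 →
      C x (t • ρ₁.1 + (1 - t) • ρ₂.1) ≤ t * C x ρ₁.1 + (1 - t) * C x ρ₂.1)
    (hdec : ∀ x : X, ∀ ρ₁ ρ₂ : PpY p Y, EOrder E.carrier ρ₁.1 ρ₂.1 → C x ρ₂.1 ≤ C x ρ₁.1)
    (μ : Measure X) [IsProbabilityMeasure μ] (ν : PpY p Y) :
    (primalY μ ν.1 C : EReal) ≤
      ⨆ ψ : {ψ : Y → ℝ // ψ ∈ E.carrier ∧ ∃ c : ℝ, ∀ y, c ≤ ψ y},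
        eInt μ (conjY p C ψ.1) - ((∫ y, ψ.1 y ∂ν.1 : ℝ) : EReal) := by
  set B := ⨆ ψ : {ψ : Y → ℝ // ψ ∈ E.carrier ∧ ∃ c : ℝ, ∀ y, c ≤ ψ y},
        eInt μ (conjY p C ψ.1) - ((∫ y, ψ.1 y ∂ν.1 : ℝ) : EReal) with hB
  have key (h : Y → ℝ) (hE : h ∈ E.carrier) (h0 : ∀ y, 0 ≤ h y) :
      ((∫⁻ x, ⨅ ρ : PpY p Y, ∫⁻ y, ENNReal.ofReal (h y) ∂ρ.1 + C x ρ.1 ∂μ : ℝ≥0∞) : EReal) ≤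
        B + ((∫ y, h y ∂ν.1 : ℝ) : EReal) := by
    refine (le_eInt_of_coe_le (coe_iInf_le_conjY (E.subset_lscp h hE) h0)).trans ?_
    refine (EReal.sub_le_iff_le_add (.inl (EReal.coe_ne_bot _)) (.inl (EReal.coe_ne_top _))).1 ?_
    exact le_iSup (fun ψ : {ψ : Y → ℝ // ψ ∈ E.carrier ∧ ∃ c : ℝ, ∀ y, c ≤ ψ y} =>
      eInt μ (conjY p C ψ.1) - ((∫ y, ψ.1 y ∂ν.1 : ℝ) : EReal)) ⟨h, hE, 0, h0⟩
  have hB0 : 0 ≤ B := by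
    have := (EReal.coe_ennreal_nonneg _).trans (key (fun _ => 0) (E.const_mem 0) fun _ => le_rfl)
    simpa using this
  by_contra! hlt
  have hBtop : B ≠ ⊤ := (hlt.trans_le le_top).ne
  have hcoe : (B.toENNReal : EReal) = B := EReal.coe_toENNReal hB0
  have hlt' : B.toENNReal < primalY μ ν.1 C := by
    rw [← EReal.coe_ennreal_lt_coe_ennreal_iff, hcoe]
    exact hlt
  obtain ⟨T⟩ := exists_testSequence.{u, v} (p := p) (Y := Y) hp
  let y₀ : Y := Classical.arbitrary Y
  obtain ⟨ψ, hψc, ⟨b, hb, hlow⟩, ⟨K, hK, hup⟩, hψ⟩ :=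
    T.exists_potential hp y₀ μ ν (c := fun x ρ => C x ρ.1) hlsc
      (fun x ρ₁ ρ₂ t ht => hconv x ρ₁ ρ₂ t ht) (t₀ := B.toENNReal) (hlt'.trans_le le_top).ne
      fun κ hκ hbind => hlt'.trans_le (primalY_le_lintegral hκ hbind)
  have hψ0 (y) : 0 ≤ ψ y := (by positivity : 0 ≤ b * dist y y₀ ^ p).trans (hlow y)
  have hmem := E.hull_mem hψ0 hup
  have hψi : Integrable ψ ν.1 :=
    LSCp.integrable ⟨hψc.lowerSemicontinuous, K, y₀, fun y => (abs_of_nonneg (hψ0 y)).trans_le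
      (hup y)⟩ ν
  have hs : ∫ y, E.hull ψ y ∂ν.1 ≤ ∫ y, ψ y ∂ν.1 :=
    integral_mono ((E.subset_lscp _ hmem).integrable ν) hψi (E.hull_le hψ0)
  have h1 := key _ hmem (E.hull_nonneg hψ0)
  have h2 : ∫⁻ x, ⨅ ρ : PpY p Y, ∫⁻ y, ENNReal.ofReal (ψ y) ∂ρ.1 + C x ρ.1 ∂μ ≤
      ∫⁻ x, ⨅ ρ : PpY p Y, ∫⁻ y, ENNReal.ofReal (E.hull ψ y) ∂ρ.1 + C x ρ.1 ∂μ :=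
    lintegral_mono (E.iInf_le_iInf_hull hp hdec hψc hb hlow hK hup)
  refine (hψ.trans_le h2).not_ge ?_
  rw [← EReal.coe_ennreal_le_coe_ennreal_iff, EReal.coe_ennreal_add, EReal.coe_ennreal_ofReal,
    max_eq_left (integral_nonneg hψ0), hcoe, add_comm]
  exact h1.trans (by gcongr)

lemma le_of_eOrder_of_duality (E : StableCone p Y)
    (h : ∀ μ : Measure X, IsProbabilityMeasure μ →
      ∀ ν : Measure Y, IsProbabilityMeasure ν → HasMomentPY p ν →
      ((primalY μ ν C : ℝ≥0∞) : EReal)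
        = ⨆ ψ : {ψ : Y → ℝ // ψ ∈ E.carrier ∧ ∃ c : ℝ, ∀ y, c ≤ ψ y},
            eInt μ (conjY p C ψ.1) - ((∫ y, ψ.1 y ∂ν : ℝ) : EReal))
    (x : X) (ρ₁ ρ₂ : PpY p Y) (hord : EOrder E.carrier ρ₁.1 ρ₂.1) : C x ρ₂.1 ≤ C x ρ₁.1 := by
  have h' (ρ : PpY p Y) := h (Measure.dirac x) inferInstance ρ.1 ρ.2.1 ρ.2.2
  simp only [primalY_dirac] at h'
  rw [← EReal.coe_ennreal_le_coe_ennreal_iff, h', h']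
  exact iSup_mono fun ψ => EReal.sub_le_sub le_rfl (EReal.coe_le_coe_iff.2 (hord ψ.1 ψ.2.1))

end Duality

/-- **Weak transport duality over a stable cone** (Theorem 12): for a stable cone `E` on a
Polish metric space `Y` and an lsc cost `C`, convex in its second argument, the duality
with potentials in `E` (bounded below) holds iff `C` is `≼_E`-decreasing in its second
argument. -/
theorem weak_transport_duality_stableCone
    {X Y : Type*} [TopologicalSpace X] [PolishSpace X] [MeasurableSpace X] [BorelSpace X]
    [MetricSpace Y] [PolishSpace Y] [MeasurableSpace Y] [BorelSpace Y] [Nonempty Y]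
    {p : ℝ} (hp : 1 ≤ p) (E : StableCone p Y)
    (C : X → Measure Y → ℝ≥0∞)
    (hlsc : LowerSemicontinuous fun q : X × PpY p Y => C q.1 q.2.1)
    (hconv : ∀ x : X, ∀ ρ₁ ρ₂ : PpY p Y, ∀ t : ℝ≥0∞, t ≤ 1 →
      C x (t • ρ₁.1 + (1 - t) • ρ₂.1) ≤ t * C x ρ₁.1 + (1 - t) * C x ρ₂.1) :
    ((∀ x : X, ∀ ρ₁ ρ₂ : PpY p Y, EOrder E.carrier ρ₁.1 ρ₂.1 → C x ρ₂.1 ≤ C x ρ₁.1) →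
      ∀ μ : Measure X, IsProbabilityMeasure μ →
      ∀ ν : Measure Y, IsProbabilityMeasure ν → HasMomentPY p ν →
      ((primalY μ ν C : ℝ≥0∞) : EReal)
        = ⨆ ψ : {ψ : Y → ℝ // ψ ∈ E.carrier ∧ ∃ c : ℝ, ∀ y, c ≤ ψ y},
            eInt μ (conjY p C ψ.1) - ((∫ y, ψ.1 y ∂ν : ℝ) : EReal))
    ∧
    ((∀ μ : Measure X, IsProbabilityMeasure μ →
      ∀ ν : Measure Y, IsProbabilityMeasure ν → HasMomentPY p ν →
      ((primalY μ ν C : ℝ≥0∞) : EReal)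
        = ⨆ ψ : {ψ : Y → ℝ // ψ ∈ E.carrier ∧ ∃ c : ℝ, ∀ y, c ≤ ψ y},
            eInt μ (conjY p C ψ.1) - ((∫ y, ψ.1 y ∂ν : ℝ) : EReal)) →
      ∀ x : X, ∀ ρ₁ ρ₂ : PpY p Y, EOrder E.carrier ρ₁.1 ρ₂.1 → C x ρ₂.1 ≤ C x ρ₁.1) := by
  have hp' : 0 ≤ p := zero_le_one.trans hp
  refine ⟨fun hdec μ _ ν hν hνp => le_antisymm ?_ (iSup_le fun ψ => ?_), le_of_eOrder_of_duality E⟩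
  · exact primalY_le_dual hp' E hlsc hconv hdec μ ⟨ν, hν, hνp⟩
  · exact dual_le_primalY hp' hlsc E μ ⟨ν, hν, hνp⟩ ψ.2.1
end

section
/- (Dilations) Let Y be a compact Polish space and E a semi-stable cone of functions on Y, and let μ, ν ∈ P(Y). Then μ ≼_E ν if and only if there exists a coupling π ∈ Π(μ,ν) such that δ_y ≼_E π_y for μ-almost every y ∈ Y. -/
open MeasureTheory Set Filter Topology
open scoped ENNReal

noncomputable section

/-- A semi-stable cone of functions on `Y`: a set of bounded lower semicontinuous
real-valued functions containing the constants, closed under conic combinations and under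
pointwise suprema that remain bounded and lower semicontinuous, and whose members are
pointwise suprema of continuous members. -/
structure SemiStableCone (Y : Type*) [TopologicalSpace Y] where
  carrier : Set (Y → ℝ)
  subset_lsc_bdd : ∀ f ∈ carrier, LowerSemicontinuous f ∧ ∃ M : ℝ, ∀ y, |f y| ≤ M
  const_mem : ∀ c : ℝ, (fun _ => c) ∈ carrier
  add_mem : ∀ f ∈ carrier, ∀ g ∈ carrier, (fun y => f y + g y) ∈ carrier
  smul_mem : ∀ c : ℝ, 0 ≤ c → ∀ f ∈ carrier, (fun y => c * f y) ∈ carrier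
  sup_mem : ∀ S : Set (Y → ℝ), S ⊆ carrier → S.Nonempty →
    (∀ y, BddAbove ((fun f : Y → ℝ => f y) '' S)) →
    (LowerSemicontinuous (fun y => ⨆ f : S, f.1 y) ∧
      ∃ M : ℝ, ∀ y, |⨆ f : S, f.1 y| ≤ M) →
    (fun y => ⨆ f : S, f.1 y) ∈ carrier
  sup_continuous : ∀ f ∈ carrier, ∃ S : Set (Y → ℝ), S ⊆ carrier ∧ S.Nonempty ∧
    (∀ g ∈ S, Continuous g) ∧ (∀ y, BddAbove ((fun g : Y → ℝ => g y) '' S)) ∧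
    ∀ y, f y = ⨆ g : S, g.1 y

end

section Dilations

variable {Y : Type*}

lemma ContinuousMap.integrable_of_compactSpace {X : Type*} [TopologicalSpace X] [CompactSpace X]
    [MeasurableSpace X] [OpensMeasurableSpace X] {ρ : Measure X} [IsFiniteMeasure ρ]
    (f : C(X, ℝ)) : Integrable f ρ :=
  Integrable.of_bound f.continuous.aestronglyMeasurable ‖f‖ (.of_forall f.norm_coe_le_norm)

namespace SemiStableCone

variable [TopologicalSpace Y]

/-- A family in a semi-stable cone dominated by a bounded function has an upper bound in the cone
that is still dominated by that function. -/
lemma exists_mem_between (E : SemiStableCone Y) {ι : Type*} [Nonempty ι]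
    (F : ι → Y → ℝ) (hF : ∀ i, F i ∈ E.carrier) (b : Y → ℝ) (hb : ∃ M, ∀ y, b y ≤ M)
    (hFb : ∀ i y, F i y ≤ b y) :
    ∃ H ∈ E.carrier, (∀ i y, F i y ≤ H y) ∧ ∀ y, H y ≤ b y := by
  have hS : range F ⊆ E.carrier := by
    rintro _ ⟨i, rfl⟩
    exact hF i
  have hne : (range F).Nonempty := range_nonempty F
  have := hne.to_subtype
  have hbdd (y : Y) : BddAbove (range fun f : range F => f.1 y) := by
    refine ⟨b y, ?_⟩
    rintro _ ⟨⟨_, i, rfl⟩, rfl⟩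
    exact hFb i y
  have hle (i : ι) (y : Y) : F i y ≤ ⨆ f : range F, f.1 y :=
    le_ciSup (hbdd y) ⟨F i, i, rfl⟩
  have hge (y : Y) : (⨆ f : range F, f.1 y) ≤ b y := by
    refine ciSup_le ?_
    rintro ⟨_, i, rfl⟩
    exact hFb i y
  refine ⟨_, E.sup_mem (range F) hS hne (fun y => ?_) ⟨?_, ?_⟩, hle, hge⟩
  · rw [image_eq_range]
    exact hbdd y
  · exact lowerSemicontinuous_ciSup hbdd fun f => (E.subset_lsc_bdd _ (hS f.2)).1
  · obtain ⟨M, hM⟩ := hb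
    obtain ⟨i⟩ := ‹Nonempty ι›
    obtain ⟨N, hN⟩ := (E.subset_lsc_bdd _ (hF i)).2
    refine ⟨max M N, fun y => abs_le.2 ⟨?_, ?_⟩⟩
    · have := (abs_le.1 (hN y)).1
      have := hle i y
      have := le_max_right M N
      linarith
    · exact (hge y).trans ((hM y).trans (le_max_left _ _))

lemma sub_const_mem (E : SemiStableCone Y) {f : Y → ℝ} (hf : f ∈ E.carrier) (c : ℝ) :
    (fun y => f y - c) ∈ E.carrier := by
  simpa only [sub_eq_add_neg] using E.add_mem f hf _ (E.const_mem (-c))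

lemma integrable [MeasurableSpace Y] [BorelSpace Y] (E : SemiStableCone Y) {f : Y → ℝ}
    (hf : f ∈ E.carrier) (ρ : Measure Y) [IsFiniteMeasure ρ] : Integrable f ρ := by
  obtain ⟨hlsc, M, hM⟩ := E.subset_lsc_bdd f hf
  exact Integrable.of_bound hlsc.measurable.aestronglyMeasurable M (.of_forall hM)

/-- The cone of continuous functions on the product which dominate `u x + h y + G x y - G x x`,
where each `G x` belongs to `E` and `∫ u dμ + ∫ h dν` is nonnegative. A positive functional for
this cone is a dilation of `μ` into `ν`. -/
def dualCone [CompactSpace Y] [MeasurableSpace Y] [BorelSpace Y] (E : SemiStableCone Y)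
    (μ ν : Measure Y) [IsFiniteMeasure μ] [IsFiniteMeasure ν] : PointedCone ℝ C(Y × Y, ℝ) where
  carrier := {φ | ∃ (u h : C(Y, ℝ)) (G : Y → Y → ℝ), (∀ x, G x ∈ E.carrier) ∧
    0 ≤ ∫ x, u x ∂μ + ∫ y, h y ∂ν ∧ ∀ x y, u x + h y + (G x y - G x x) ≤ φ (x, y)}
  add_mem' := by
    rintro φ ψ ⟨u, h, G, hG, hpos, hφ⟩ ⟨u', h', G', hG', hpos', hψ⟩
    refine ⟨u + u', h + h', fun x y => G x y + G' x y, fun x => E.add_mem _ (hG x) _ (hG' x),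
      ?_, fun x y => ?_⟩
    · simp only [ContinuousMap.add_apply]
      rw [integral_add, integral_add]
      · linarith
      all_goals exact ContinuousMap.integrable_of_compactSpace _
    · have := hφ x y
      have := hψ x y
      simp only [ContinuousMap.add_apply]
      linarith
  zero_mem' := ⟨0, 0, fun _ _ => 0, fun _ => E.const_mem 0, by simp, by simp⟩
  smul_mem' := by
    rintro ⟨c, hc⟩ φ ⟨u, h, G, hG, hpos, hφ⟩
    refine ⟨c • u, c • h, fun x y => c * G x y, fun x => E.smul_mem c hc _ (hG x), ?_,
      fun x y => ?_⟩
    · simp only [ContinuousMap.smul_apply, smul_eq_mul, integral_const_mul]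
      rw [← mul_add]
      positivity
    · have := mul_le_mul_of_nonneg_left (hφ x y) hc
      change c * u x + c * h y + (c * G x y - c * G x x) ≤ c * φ (x, y)
      linarith

variable [CompactSpace Y] [MeasurableSpace Y] [BorelSpace Y] {E : SemiStableCone Y}
  {μ ν : Measure Y}

lemma nonneg_of_const_mem_dualCone [Nonempty Y] [IsProbabilityMeasure μ] [IsProbabilityMeasure ν]
    (hE : EOrder E.carrier μ ν) {c : ℝ} (hc : ContinuousMap.const (Y × Y) c ∈ E.dualCone μ ν) :
    0 ≤ c := by
  obtain ⟨u, h, G, hG, hpos, hle⟩ := hc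
  obtain ⟨m, hm⟩ := (isCompact_range h.continuous).bddBelow
  obtain ⟨H, hH, hFH, hHb⟩ := E.exists_mem_between (fun x y => G x y - (G x x - u x))
    (fun x => E.sub_const_mem (hG x) _) (fun y => c - h y)
    ⟨c - m, fun y => sub_le_sub_left (hm ⟨y, rfl⟩) c⟩ (fun x y => by
      have := hle x y
      simp only [ContinuousMap.const_apply] at this
      linarith)
  have h1 : ∫ x, u x ∂μ ≤ ∫ x, H x ∂μ :=
    integral_mono u.integrable_of_compactSpace (E.integrable hH μ) fun x => by
      have := hFH x x
      simp only at this ⊢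
      linarith
  have h2 : ∫ y, H y ∂ν ≤ ∫ y, (c - h y) ∂ν :=
    integral_mono (E.integrable hH ν)
      ((integrable_const c).sub h.integrable_of_compactSpace) hHb
  rw [integral_sub (integrable_const c) h.integrable_of_compactSpace] at h2
  have h3 := hE H hH
  simp only [integral_const, probReal_univ, smul_eq_mul, one_mul] at h2
  linarith

lemma mem_dualCone_of_nonneg [IsFiniteMeasure μ] [IsFiniteMeasure ν] {φ : C(Y × Y, ℝ)}
    (hφ : 0 ≤ φ) : φ ∈ E.dualCone μ ν :=
  ⟨0, 0, fun _ _ => 0, fun _ => E.const_mem 0, by simp, fun x y => by simpa using hφ (x, y)⟩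

/-- If `μ ≼_E ν`, some normalized linear functional is nonnegative on `E.dualCone μ ν`. -/
lemma exists_linearMap_nonneg_on_dualCone [Nonempty Y] [IsProbabilityMeasure μ]
    [IsProbabilityMeasure ν] (hE : EOrder E.carrier μ ν) :
    ∃ L : C(Y × Y, ℝ) →ₗ[ℝ] ℝ, L 1 = 1 ∧ ∀ φ ∈ E.dualCone μ ν, 0 ≤ L φ := by
  have hne : (1 : C(Y × Y, ℝ)) ≠ 0 := one_ne_zero
  let f : C(Y × Y, ℝ) →ₗ.[ℝ] ℝ := LinearPMap.mkSpanSingleton 1 1 hne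
  have hf (c : ℝ) (h : c • (1 : C(Y × Y, ℝ)) ∈ f.domain) : f ⟨c • 1, h⟩ = c := by
    exact (LinearPMap.mkSpanSingleton'_apply (σ := RingHom.id ℝ) (1 : C(Y × Y, ℝ)) (1 : ℝ)
      _ c h).trans (mul_one c)
  have hmem (c : ℝ) : c • (1 : C(Y × Y, ℝ)) ∈ f.domain :=
    Submodule.smul_mem _ _ (Submodule.mem_span_singleton_self _)
  have hnonneg (x : f.domain) (hx : (x : C(Y × Y, ℝ)) ∈ E.dualCone μ ν) : 0 ≤ f x := by
    obtain ⟨x, hxf⟩ := x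
    obtain ⟨c, rfl⟩ := Submodule.mem_span_singleton.1 hxf
    have hc : c • (1 : C(Y × Y, ℝ)) = ContinuousMap.const _ c := by ext; simp
    rw [hf]
    simp only [hc] at hx
    exact nonneg_of_const_mem_dualCone hE hx
  have hdense (φ : C(Y × Y, ℝ)) : ∃ x : f.domain, (x : C(Y × Y, ℝ)) + φ ∈ E.dualCone μ ν := by
    refine ⟨⟨‖φ‖ • 1, hmem _⟩, mem_dualCone_of_nonneg fun p => ?_⟩
    have := (abs_le.1 (φ.norm_coe_le_norm p)).1
    change 0 ≤ ‖φ‖ * 1 + φ p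
    linarith
  obtain ⟨L, hL, hpos⟩ := riesz_extension (E.dualCone μ ν) f hnonneg hdense
  exact ⟨L, by simpa only [one_smul] using (hL ⟨(1 : ℝ) • 1, hmem 1⟩).trans (hf 1 _), hpos⟩

end SemiStableCone

/-- **Riesz–Markov–Kakutani** for a positive functional on `C(X, ℝ)`, `X` compact. -/
lemma exists_isFiniteMeasure_integral_eq {X : Type*} [TopologicalSpace X] [T2Space X]
    [CompactSpace X] [MeasurableSpace X] [BorelSpace X] (L : C(X, ℝ) →ₗ[ℝ] ℝ)
    (hL : ∀ φ, 0 ≤ φ → 0 ≤ L φ) :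
    ∃ π : Measure X, IsFiniteMeasure π ∧ ∀ φ : C(X, ℝ), ∫ x, φ x ∂π = L φ := by
  let Λ : CompactlySupportedContinuousMap X ℝ →ₚ[ℝ] ℝ := PositiveLinearMap.mk₀
    { toFun := fun f => L f.toContinuousMap
      map_add' := fun f g => L.map_add f.toContinuousMap g.toContinuousMap
      map_smul' := fun c f => L.map_smul c f.toContinuousMap }
    fun f hf => hL f.toContinuousMap hf
  exact ⟨RealRMK.rieszMeasure Λ, inferInstance, fun φ =>
    RealRMK.integral_rieszMeasure Λ (CompactlySupportedContinuousMap.continuousMapEquiv φ)⟩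

/-- A bounded function whose integral against every nonnegative continuous function is
nonnegative is almost everywhere nonnegative. -/
lemma ae_nonneg_of_forall_integral_continuous_mul_nonneg {X : Type*} [TopologicalSpace X]
    [NormalSpace X] [MeasurableSpace X] [BorelSpace X] {μ : Measure X}
    [IsFiniteMeasure μ] [μ.WeaklyRegular] {k : X → ℝ} (hk : AEStronglyMeasurable k μ) {M : ℝ}
    (hM0 : 0 ≤ M) (hM : ∀ x, |k x| ≤ M)
    (h : ∀ a : BoundedContinuousFunction X ℝ, (∀ x, 0 ≤ a x) → 0 ≤ ∫ x, a x * k x ∂μ) :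
    ∀ᵐ x ∂μ, 0 ≤ k x := by
  have hki : Integrable k μ := Integrable.of_bound hk M (.of_forall hM)
  have hn : AEStronglyMeasurable (fun x => max (-k x) 0) μ :=
    (hk.neg.sup aestronglyMeasurable_const)
  have hnb (x : X) : |max (-k x) 0| ≤ M := by
    rw [abs_of_nonneg (le_max_right _ _)]
    exact max_le ((neg_le_abs _).trans (hM x)) ((abs_nonneg _).trans (hM x))
  have hsq : Integrable (fun x => max (-k x) 0 ^ 2) μ := by
    refine Integrable.of_bound (hn.pow 2) (M ^ 2) (.of_forall fun x => ?_)
    rw [Real.norm_eq_abs, abs_pow]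
    exact pow_le_pow_left₀ (abs_nonneg _) (hnb x) 2
  have hbound (ε : ℝ) (hε : 0 < ε) : ∫ x, max (-k x) 0 ^ 2 ∂μ ≤ M * ε := by
    obtain ⟨b, hb, hbi⟩ := hki.exists_boundedContinuous_integral_sub_le hε
    let a : BoundedContinuousFunction X ℝ := (-b) ⊔ 0
    have ha (x : X) : a x = max (-b x) 0 := rfl
    have hdi : Integrable (fun x => M * ‖k x - b x‖) μ := (hki.sub hbi).norm.const_mul M
    have hak : Integrable (fun x => a x * k x) μ := by
      refine hki.bdd_mul a.continuous.aestronglyMeasurable (c := ‖a‖) ?_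
      exact .of_forall fun x => a.norm_coe_le_norm x
    have h0 := h a fun x => le_max_right _ _
    have hpt (x : X) : max (-k x) 0 ^ 2 + a x * k x ≤ M * ‖k x - b x‖ := by
      have h1 : max (-k x) 0 ^ 2 = - (max (-k x) 0 * k x) := by
        rcases le_total (-k x) 0 with h | h
        · simp [max_eq_right h]
        · rw [max_eq_left h]; ring
      have h2 : |a x - max (-k x) 0| ≤ ‖k x - b x‖ := by
        rw [ha]
        refine (abs_max_sub_max_le_abs _ _ _).trans_eq ?_
        rw [Real.norm_eq_abs]
        congr 1
        ring
      calc max (-k x) 0 ^ 2 + a x * k x = (a x - max (-k x) 0) * k x := by rw [h1]; ring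
        _ ≤ |(a x - max (-k x) 0) * k x| := le_abs_self _
        _ = |k x| * |a x - max (-k x) 0| := by rw [abs_mul, mul_comm]
        _ ≤ M * ‖k x - b x‖ :=
          mul_le_mul (hM x) h2 (abs_nonneg _) hM0
    have hint := integral_mono (hsq.add hak) hdi hpt
    simp only [Pi.add_apply] at hint
    rw [integral_add hsq hak, integral_const_mul] at hint
    have := mul_le_mul_of_nonneg_left hb hM0
    linarith
  have hzero : ∫ x, max (-k x) 0 ^ 2 ∂μ ≤ 0 := by
    have : Tendsto (fun ε : ℝ => M * ε) (𝓝[Ioi 0] 0) (𝓝 0) := by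
      have : Tendsto (fun ε : ℝ => M * ε) (𝓝 0) (𝓝 (M * 0)) := by
        exact (continuous_const.mul continuous_id).tendsto 0
      rw [mul_zero] at this
      exact this.mono_left nhdsWithin_le_nhds
    exact ge_of_tendsto this (eventually_mem_nhdsWithin.mono fun ε hε => hbound ε hε)
  have hae := (integral_eq_zero_iff_of_nonneg (fun x => sq_nonneg (max (-k x) 0)) hsq).1
    (le_antisymm hzero (integral_nonneg fun x => sq_nonneg _))
  filter_upwards [hae] with x hx
  have : max (-k x) 0 = 0 := by simpa using hx
  have := max_eq_right_iff.1 this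
  linarith

/-- Domination of a point mass is determined by the continuous members of the cone, and among
these by a dense subset. -/
lemma SemiStableCone.eOrder_dirac_of_dense [TopologicalSpace Y] [CompactSpace Y]
    [MeasurableSpace Y] [BorelSpace Y] [MeasurableSingletonClass Y] (E : SemiStableCone Y)
    {D : Set C(Y, ℝ)} (hD : {g : C(Y, ℝ) | ⇑g ∈ E.carrier} ⊆ closure D) {y : Y} {ρ : Measure Y}
    [IsFiniteMeasure ρ] (h : ∀ g ∈ D, g y ≤ ∫ z, g z ∂ρ) :
    EOrder E.carrier (Measure.dirac y) ρ := by
  have hclosed : IsClosed {g : C(Y, ℝ) | g y ≤ ∫ z, g z ∂ρ} := by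
    refine isClosed_le (continuous_eval_const y) ?_
    refine (LipschitzWith.of_dist_le_mul (K := (ρ.real univ).toNNReal)
      fun f g => ?_).continuous
    rw [Real.dist_eq, ← integral_sub f.integrable_of_compactSpace g.integrable_of_compactSpace,
      Real.coe_toNNReal _ measureReal_nonneg, mul_comm]
    exact norm_integral_le_of_norm_le_const (f := fun z => f z - g z) (.of_forall fun z =>
      (Real.dist_eq (f z) (g z)).symm.trans_le (ContinuousMap.dist_apply_le_dist z))
  intro f hf
  rw [integral_dirac]
  obtain ⟨S, hS, hne, hcont, hbdd, hsup⟩ := E.sup_continuous f hf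
  have := hne.to_subtype
  rw [hsup y]
  refine ciSup_le fun g => ?_
  have hg : (⟨g.1, hcont _ g.2⟩ : C(Y, ℝ)) ∈ {g : C(Y, ℝ) | g y ≤ ∫ z, g z ∂ρ} :=
    closure_minimal h hclosed (hD (hS g.2))
  refine le_trans hg (integral_mono (E.integrable (hS g.2) ρ) (E.integrable hf ρ) fun z => ?_)
  rw [hsup z]
  exact le_ciSup (f := fun g : S => g.1 z) (by simpa only [image_eq_range] using hbdd z) g

lemma disint_eq_condKernel {X : Type*} [MeasurableSpace X] [MeasurableSpace Y]
    [StandardBorelSpace Y] [Nonempty Y] (π : Measure (X × Y)) [hπ : IsFiniteMeasure π] :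
    disint π = π.condKernel := by
  rw [disint, dif_pos hπ]

/-- Dominating point masses almost surely along a coupling gives domination of the marginals. -/
lemma SemiStableCone.eOrder_of_dilation [TopologicalSpace Y] [MeasurableSpace Y]
    [BorelSpace Y] [StandardBorelSpace Y] [Nonempty Y] (E : SemiStableCone Y) {μ ν : Measure Y}
    {π : Measure (Y × Y)} (hπ : IsCoupling π μ ν)
    (h : ∀ᵐ y ∂μ, EOrder E.carrier (Measure.dirac y) (disint π y)) : EOrder E.carrier μ ν := by
  obtain ⟨hprob, hfst, hsnd⟩ := hπ
  rw [disint_eq_condKernel] at h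
  change π.fst = μ at hfst
  change π.snd = ν at hsnd
  subst hfst hsnd
  intro f hf
  have hfi : Integrable (fun p : Y × Y => f p.2) π :=
    (E.integrable hf π.snd).comp_measurable measurable_snd
  have hsnd : ∫ y, f y ∂π.snd = ∫ p, f p.2 ∂π :=
    integral_map measurable_snd.aemeasurable (E.integrable hf π.snd).aestronglyMeasurable
  rw [hsnd, ← Measure.integral_condKernel hfi]
  refine integral_mono_ae (E.integrable hf _) hfi.integral_condKernel ?_
  filter_upwards [h] with y hy
  simpa using hy f hf

/-- Almost sure domination along the disintegration, tested against one continuous function. -/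
lemma ae_le_integral_condKernel [TopologicalSpace Y] [CompactSpace Y] [T2Space Y]
    [SecondCountableTopology Y] [MeasurableSpace Y] [BorelSpace Y] [StandardBorelSpace Y]
    [Nonempty Y] (π : Measure (Y × Y)) [IsFiniteMeasure π] [π.fst.WeaklyRegular] (g : C(Y, ℝ))
    (h : ∀ a : BoundedContinuousFunction Y ℝ, (∀ x, 0 ≤ a x) →
      0 ≤ ∫ p, a p.1 * (g p.2 - g p.1) ∂π) :
    ∀ᵐ x ∂π.fst, g x ≤ ∫ y, g y ∂π.condKernel x := by
  have hgi : Integrable (fun p : Y × Y => g p.2) π :=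
    (g.comp ⟨Prod.snd, continuous_snd⟩).integrable_of_compactSpace
  have hgm := hgi.integral_condKernel.aestronglyMeasurable
  have key : ∀ᵐ x ∂π.fst, 0 ≤ (∫ y, g y ∂π.condKernel x) - g x := by
    refine ae_nonneg_of_forall_integral_continuous_mul_nonneg (M := ‖g‖ + ‖g‖)
      (hgm.sub g.continuous.aestronglyMeasurable) (by positivity) (fun x => ?_) fun a ha => ?_
    · refine (abs_sub _ _).trans (add_le_add ?_ (g.norm_coe_le_norm x))
      simpa using norm_integral_le_of_norm_le_const (μ := π.condKernel x)
        (.of_forall g.norm_coe_le_norm)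
    · have hi : Integrable (fun p : Y × Y => a p.1 * (g p.2 - g p.1)) π :=
        ContinuousMap.integrable_of_compactSpace
          ⟨fun p : Y × Y => a p.1 * (g p.2 - g p.1), by fun_prop⟩
      have h0 := h a ha
      rw [← Measure.integral_condKernel hi] at h0
      convert h0 using 3 with x
      simp only
      rw [integral_const_mul, integral_sub g.integrable_of_compactSpace (integrable_const _)]
      simp
  filter_upwards [key] with x hx using sub_nonneg.1 hx

/-- Strassen-type existence of a dilation. -/
lemma SemiStableCone.exists_dilation [MetricSpace Y] [CompactSpace Y] [PolishSpace Y]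
    [MeasurableSpace Y] [BorelSpace Y] [Nonempty Y] (E : SemiStableCone Y) {μ ν : Measure Y}
    [IsProbabilityMeasure μ] [IsProbabilityMeasure ν] (hE : EOrder E.carrier μ ν) :
    ∃ π : Measure (Y × Y), IsCoupling π μ ν ∧
      ∀ᵐ y ∂μ, EOrder E.carrier (Measure.dirac y) (disint π y) := by
  obtain ⟨L, hL1, hL⟩ := exists_linearMap_nonneg_on_dualCone hE
  obtain ⟨π, hfin, hπ⟩ := exists_isFiniteMeasure_integral_eq L fun φ hφ =>
    hL φ (mem_dualCone_of_nonneg hφ)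
  have hmarg (u h : C(Y, ℝ)) (huh : 0 ≤ ∫ x, u x ∂μ + ∫ y, h y ∂ν) :
      0 ≤ ∫ p, (u p.1 + h p.2) ∂π := by
    have := hL ⟨fun p => u p.1 + h p.2, by fun_prop⟩
      ⟨u, h, fun _ _ => 0, fun _ => E.const_mem 0, huh, fun x y => by simp⟩
    rwa [← hπ] at this
  have hprob : IsProbabilityMeasure π := by
    have h1 := hπ 1
    simp only [ContinuousMap.one_apply, integral_const, smul_eq_mul, mul_one, hL1] at h1
    exact ⟨by rw [← ENNReal.toReal_eq_one_iff]; exact h1⟩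
  have hint (u : C(Y, ℝ)) {f : Y × Y → Y} (hf : Continuous f) :
      Integrable (fun p => u (f p)) π :=
    (u.comp ⟨f, hf⟩).integrable_of_compactSpace
  have hfst : π.fst = μ := by
    refine ext_of_forall_integral_eq_of_IsFiniteMeasure fun f => ?_
    rw [Measure.fst, integral_map measurable_fst.aemeasurable f.continuous.aestronglyMeasurable]
    have h1 := hmarg f.toContinuousMap (.const Y (-∫ x, f x ∂μ)) (by simp)
    have h2 := hmarg (-f.toContinuousMap) (.const Y (∫ x, f x ∂μ)) (by simp [integral_neg])
    have hi : Integrable (fun p : Y × Y => f p.1) π := hint f.toContinuousMap continuous_fst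
    simp only [ContinuousMap.const_apply, ContinuousMap.neg_apply,
      BoundedContinuousFunction.coe_toContinuousMap] at h1 h2
    rw [integral_add hi (integrable_const _)] at h1
    rw [integral_add hi.fun_neg (integrable_const _), integral_neg] at h2
    simp only [integral_const, probReal_univ, smul_eq_mul, one_mul] at h1 h2
    linarith
  have hsnd : π.snd = ν := by
    refine ext_of_forall_integral_eq_of_IsFiniteMeasure fun f => ?_
    rw [Measure.snd, integral_map measurable_snd.aemeasurable f.continuous.aestronglyMeasurable]
    have h1 := hmarg (.const Y (-∫ x, f x ∂ν)) f.toContinuousMap (by simp)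
    have h2 := hmarg (.const Y (∫ x, f x ∂ν)) (-f.toContinuousMap) (by simp [integral_neg])
    have hi : Integrable (fun p : Y × Y => f p.2) π := hint f.toContinuousMap continuous_snd
    simp only [ContinuousMap.const_apply, ContinuousMap.neg_apply,
      BoundedContinuousFunction.coe_toContinuousMap] at h1 h2
    rw [integral_add (integrable_const _) hi] at h1
    rw [integral_add (integrable_const _) hi.fun_neg, integral_neg] at h2
    simp only [integral_const, probReal_univ, smul_eq_mul, one_mul] at h1 h2
    linarith
  refine ⟨π, ⟨hprob, hfst, hsnd⟩, ?_⟩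
  obtain ⟨D, hDE, hDc, hD⟩ := (TopologicalSpace.IsSeparable.of_separableSpace
    {g : C(Y, ℝ) | ⇑g ∈ E.carrier}).exists_countable_dense_subset
  have hall : ∀ᵐ x ∂π.fst, ∀ g ∈ D, g x ≤ ∫ y, g y ∂π.condKernel x := by
    refine (ae_ball_iff hDc).2 fun g hg => ae_le_integral_condKernel π g fun a ha => ?_
    have := hL ⟨fun p => a p.1 * (g p.2 - g p.1), by fun_prop⟩
      ⟨0, 0, fun x y => a x * g y, fun x => E.smul_mem _ (ha x) _ (hDE hg), by simp,
        fun x y => by simp [mul_sub]⟩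
    rwa [← hπ] at this
  rw [disint_eq_condKernel, ← hfst]
  filter_upwards [hall] with y hy using E.eOrder_dirac_of_dense hD hy

end Dilations

/-- **Dilations** (Theorem 13): on a compact Polish space `Y` with a semi-stable cone `E`,
`μ ≼_E ν` iff there is a coupling `π ∈ Π(μ,ν)` with `δ_y ≼_E π_y` for `μ`-a.e. `y`. -/
theorem dilation_exists_iff_EOrder
    {Y : Type*} [MetricSpace Y] [CompactSpace Y] [PolishSpace Y]
    [MeasurableSpace Y] [BorelSpace Y] [Nonempty Y]
    (E : SemiStableCone Y) (μ ν : Measure Y)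
    (hμ : IsProbabilityMeasure μ) (hν : IsProbabilityMeasure ν) :
    EOrder E.carrier μ ν ↔
      ∃ π : Measure (Y × Y), IsCoupling π μ ν ∧
        ∀ᵐ y ∂μ, EOrder E.carrier (Measure.dirac y) (disint π y) := by
  refine ⟨fun h => E.exists_dilation h, ?_⟩
  rintro ⟨π, hπ, h⟩
  exact E.eOrder_of_dilation hπ h
end
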